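/- arXiv:1308.6514 — 2 statements merged into one kernel-verified Lean document; each statement's English description precedes it below -/
import Mathlib

section
/- Let b : X × Ω → ℝ be a normalized Lipschitz potential and π ∈ Π(·,σ) with Jacobian J_π. Then 0 ≤ −∫ log(J_π) dπ ≤ −∫ b dπ, with equality in the second inequality if and only if b = log(J_π) π-a.e. -/
open MeasureTheory Filter Topology

attribute [local instance] PiNat.dist

/-- The Bernoulli space `{1,...,d}^ℕ`, with the metric `dist z y = (1/2)^n` where `n`
is the first coordinate at which `z` and `y` differ (provided by `PiNat.dist`). -/
abbrev W (d : ℕ) : Type := ℕ → Fin d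

/-- The shift map `σ` on the Bernoulli space. -/
def shift {d : ℕ} (y : W d) : W d := fun n => y (n + 1)

/-- Prepend the symbol `a` to the sequence `y`, i.e. the point `a y` (a preimage of `y`
under the shift). -/
def cons {d : ℕ} (a : Fin d) (y : W d) : W d := fun n =>
  match n with
  | 0 => a
  | Nat.succ k => y k

variable {X : Type*} [Fintype X] [MeasurableSpace X] [TopologicalSpace X] {d : ℕ}

/-- `π ∈ Π(·,σ)`: a Borel probability on `X × Ω` whose `y`-marginal is `σ`-invariant. -/
def IsPlan (π : Measure (X × W d)) : Prop :=
  IsProbabilityMeasure π ∧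
    ∀ g : W d → ℝ, Continuous g → ∫ p, g (shift p.2) ∂π = ∫ p, g p.2 ∂π

/-- A cost `c` is normalized if `∑_{x ∈ X} ∑_{σ w = y} e^{c(x,w)} = 1` for every `y`. -/
def IsNormalized (c : X × W d → ℝ) : Prop :=
  ∀ y : W d, ∑ x : X, ∑ a : Fin d, Real.exp (c (x, cons a y)) = 1

/-- `π` is a fixed point of the dual transfer operator `L̂_c^*`, i.e. a Gibbs plan for `c`. -/
def GibbsFixed (c : X × W d → ℝ) (π : Measure (X × W d)) : Prop :=
  ∀ u : X × W d → ℝ, Continuous u →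
    ∫ p, u p ∂π =
      ∫ p, ∑ x : X, ∑ a : Fin d,
        Real.exp (c (x, cons a p.2)) * u (x, cons a p.2) ∂π

/-- `c` is a Lipschitz cost: Lipschitz in the `Ω` variable, uniformly in `x ∈ X`. -/
def LipCost (c : X × W d → ℝ) : Prop :=
  ∃ K : ℝ, ∀ (x : X) (y z : W d), |c (x, y) - c (x, z)| ≤ K * dist y z

/-- The entropy of a plan: `H(π) = inf { -∫ b dπ : b normalized }`. -/
noncomputable def Hent (π : Measure (X × W d)) : ℝ :=
  sInf {r | ∃ b : X × W d → ℝ, LipCost b ∧ IsNormalized b ∧ r = -∫ p, b p ∂π}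

/-- The pressure `P(c) = sup_{π ∈ Π(·,σ)} ∫ c dπ + H(π)`. -/
noncomputable def Pr (c : X × W d → ℝ) : ℝ :=
  sSup {r | ∃ π : Measure (X × W d), IsPlan π ∧ r = ∫ p, c p ∂π + Hent π}

lemma aux_dens {ν ρ : Measure (W d)} [IsFiniteMeasure ν] [IsFiniteMeasure ρ] (f : W d → ℝ)
    (hfm : Measurable f) (hfi : Integrable f ν)
    (h : ∀ g : W d → ℝ, Continuous g → ∫ y, f y * g y ∂ν = ∫ y, g y ∂ρ) :
    (∀ᵐ y ∂ν, 0 ≤ f y) ∧ ρ = ν.withDensity (fun y => ENNReal.ofReal (f y)) := by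
  have m1 : Measurable (fun y => ENNReal.ofReal (f y)) := hfm.ennreal_ofReal
  have m2 : Measurable (fun y => ENNReal.ofReal (-f y)) := hfm.neg.ennreal_ofReal
  have : IsFiniteMeasure (ν.withDensity (fun y => ENNReal.ofReal (f y))) :=
    isFiniteMeasure_withDensity_ofReal hfi.2
  have : IsFiniteMeasure (ν.withDensity (fun y => ENNReal.ofReal (-f y))) :=
    isFiniteMeasure_withDensity_ofReal hfi.neg.2
  have key : ν.withDensity (fun y => ENNReal.ofReal (f y))
      = ρ + ν.withDensity (fun y => ENNReal.ofReal (-f y)) := by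
    apply ext_of_forall_integral_eq_of_IsFiniteMeasure
    intro g
    have hgi : ∀ (μ : Measure (W d)) [IsFiniteMeasure μ], Integrable (fun y => g y) μ :=
      fun μ _ => g.integrable μ
    rw [integral_add_measure (hgi _) (hgi _), ← h g g.continuous,
      integral_withDensity_eq_integral_toReal_smul m1 (by simp),
      integral_withDensity_eq_integral_toReal_smul m2 (by simp), ← integral_add]
    · apply integral_congr_ae
      filter_upwards with y
      simp only [ENNReal.toReal_ofReal', smul_eq_mul]
      rw [← add_mul]
      congr 1
      rcases le_total (f y) 0 with h0 | h0
      · rw [max_eq_right h0, max_eq_left (by linarith)]; ring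
      · rw [max_eq_left h0, max_eq_right (by linarith)]; ring
    · exact hfi.mul_bdd (c := ‖g‖) g.continuous.aestronglyMeasurable
        (Eventually.of_forall fun y => g.norm_coe_le_norm y)
    · have := (integrable_withDensity_iff_integrable_smul' (μ := ν) (g := fun y => g y)
        m2 (by simp)).1 (hgi _)
      exact this
  have hS : MeasurableSet {y | f y < 0} := measurableSet_lt hfm measurable_const
  have h0 : ν.withDensity (fun y => ENNReal.ofReal (-f y)) {y | f y < 0} = 0 := by
    have h1 : ν.withDensity (fun y => ENNReal.ofReal (f y)) {y | f y < 0} = 0 := by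
      rw [withDensity_apply _ hS, setLIntegral_eq_zero_iff hS m1]
      filter_upwards with y hy
      exact ENNReal.ofReal_eq_zero.2 (le_of_lt hy)
    rw [key] at h1
    simp only [Measure.coe_add, Pi.add_apply, add_eq_zero] at h1
    exact h1.2
  have hnn : ∀ᵐ y ∂ν, 0 ≤ f y := by
    rw [withDensity_apply _ hS, setLIntegral_eq_zero_iff hS m2] at h0
    filter_upwards [h0] with y hy
    by_contra hc
    have := ENNReal.ofReal_eq_zero.1 (hy (not_le.1 hc))
    linarith
  refine ⟨hnn, ?_⟩
  have hz : ν.withDensity (fun y => ENNReal.ofReal (-f y)) = 0 := by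
    rw [withDensity_eq_zero_iff m2.aemeasurable]
    filter_upwards [hnn] with y hy
    exact ENNReal.ofReal_eq_zero.2 (by linarith)
  rw [key, hz, add_zero]

lemma aux_cons_meas (a : Fin d) : Measurable (cons a : W d → W d) := by
  rw [measurable_pi_iff]
  intro n
  cases n with
  | zero => exact measurable_const
  | succ k => exact measurable_pi_apply k

lemma aux_cons_cont (a : Fin d) : Continuous (cons a : W d → W d) := by
  rw [continuous_pi_iff]
  intro n
  cases n with
  | zero => exact continuous_const
  | succ k => exact continuous_apply k

lemma aux_shift_cont : Continuous (shift : W d → W d) := by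
  rw [continuous_pi_iff]
  intro n
  exact continuous_apply (n + 1)

lemma aux_shift_meas : Measurable (shift : W d → W d) := by
  rw [measurable_pi_iff]
  intro n
  exact measurable_pi_apply (n + 1)

lemma aux_cons_shift (y : W d) : cons (y 0) (shift y) = y := by
  funext n
  cases n <;> rfl

lemma aux_lip_cont {b : X × W d → ℝ} (hb : LipCost b) (x : X) :
    Continuous (fun y => b (x, y)) := by
  obtain ⟨K, hK⟩ := hb
  letI : MetricSpace (W d) := PiNat.metricSpace
  have : LipschitzWith (Real.toNNReal |K|) (fun y => b (x, y)) := by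
    apply LipschitzWith.of_dist_le_mul
    intro y z
    rw [Real.dist_eq, Real.coe_toNNReal _ (abs_nonneg K)]
    exact (hK x y z).trans (mul_le_mul_of_nonneg_right (le_abs_self K) dist_nonneg)
  exact this.continuous

/-- Continuity of functions supported on unions of cylinders. -/
lemma aux_cont [DiscreteTopology X] (g : X → Fin d → W d → ℝ) (hg : ∀ x a, Continuous (g x a)) :
    Continuous (fun p : X × W d => g p.1 (p.2 0) (shift p.2)) := by
  rw [continuous_prod_of_discrete_left]
  intro x
  have h2 : Continuous (fun q : Fin d × W d => g x q.1 q.2) := by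
    rw [continuous_prod_of_discrete_left]
    intro a
    exact hg x a
  exact h2.comp ((continuous_apply 0).prodMk aux_shift_cont)

lemma aux_main [DiscreteTopology X]
    (pl : Measure (X × W d)) [IsProbabilityMeasure pl]
    (J : X × W d → ℝ) (hJmeas : Measurable J)
    (hJsum : ∀ᵐ p ∂pl, ∑ x : X, ∑ a : Fin d, J (x, cons a p.2) = 1)
    (hCoV : ∀ w : X × W d → ℝ, Continuous w →
      ∫ p, ∑ x : X, ∑ a : Fin d,
          J (x, cons a p.2) * w (x, cons a p.2) ∂pl = ∫ p, w p ∂pl) :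
    (∀ x : X, NullMeasurableSet {p : X × W d | p.1 = x} pl) ∧
    ∀ x a, (∀ᵐ p ∂pl, 0 ≤ J (x, cons a p.2)) ∧
      ∀ F : W d → ENNReal, Measurable F →
        ∫⁻ p in {p : X × W d | p.1 = x ∧ p.2 0 = a}, F p.2 ∂pl =
        ∫⁻ p, ENNReal.ofReal (J (x, cons a p.2)) * F (cons a p.2) ∂pl := by
  classical
  -- change of variables in convenient form
  have hC : ∀ g : X → Fin d → W d → ℝ, (∀ x a, Continuous (g x a)) →
      ∫ p, ∑ x : X, ∑ a : Fin d, J (x, cons a p.2) * g x a p.2 ∂pl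
        = ∫ p, g p.1 (p.2 0) (shift p.2) ∂pl := fun g hg => hCoV _ (aux_cont g hg)
  have hatom : ∀ x x' y, x' ∈ measurableAtom x → J (x', y) = J (x, y) := by
    intro x x' y hx'
    have hm : Measurable (fun x => J (x, y)) := hJmeas.comp measurable_prodMk_right
    exact mem_of_mem_measurableAtom hx' (hm (measurableSet_singleton (J (x, y)))) rfl
  have hcoord : ∀ a : Fin d, MeasurableSet {p : X × W d | p.2 0 = a} := fun a =>
    (show Measurable fun p : X × W d => p.2 0 from
      (measurable_pi_apply 0).comp measurable_snd) (measurableSet_singleton a)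
  have hAtm : ∀ x : X, MeasurableSet {p : X × W d | p.1 ∈ measurableAtom x} := fun x =>
    measurable_fst (MeasurableSet.measurableAtom_of_countable x)
  have hcard : ∀ x : X, (0 : ℝ) < (Finset.univ.filter (fun x' => x' ∈ measurableAtom x)).card := by
    intro x
    have : 0 < (Finset.univ.filter (fun x' => x' ∈ measurableAtom x)).card :=
      Finset.card_pos.2 ⟨x, by simp⟩
    exact_mod_cast this
  have hfm : ∀ x a, Measurable (fun y => J (x, cons a y)) := fun x a =>
    hJmeas.comp (measurable_prodMk_left.comp (aux_cons_meas a))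
  -- integrability of branches
  have hInt : ∀ x a, Integrable (fun p : X × W d => J (x, cons a p.2)) pl := by
    intro x a
    have e := hC (fun x' a' _ => 1 + if x' ∈ measurableAtom x ∧ a' = a then 1 else 0)
      (fun _ _ => continuous_const)
    set c : ℝ := ((Finset.univ.filter (fun x' => x' ∈ measurableAtom x)).card : ℝ) with hc
    have e1 : (fun p : X × W d => ∑ x' : X, ∑ a' : Fin d, J (x', cons a' p.2) *
        (1 + if x' ∈ measurableAtom x ∧ a' = a then (1 : ℝ) else 0))
        =ᵐ[pl] fun p => 1 + c * J (x, cons a p.2) := by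
      filter_upwards [hJsum] with p hp
      simp only [mul_add, mul_one, Finset.sum_add_distrib, hp]
      congr 1
      have : ∀ x' : X, ∑ a' : Fin d, J (x', cons a' p.2) *
          (if x' ∈ measurableAtom x ∧ a' = a then (1 : ℝ) else 0)
          = if x' ∈ measurableAtom x then J (x, cons a p.2) else 0 := by
        intro x'
        by_cases hx' : x' ∈ measurableAtom x
        · simp [hx', hatom x x' _ hx']
        · simp [hx']
      rw [Finset.sum_congr rfl (fun x' _ => this x'), ← Finset.sum_filter, Finset.sum_const,
        nsmul_eq_mul]
    have hms : MeasurableSet {p : X × W d | p.1 ∈ measurableAtom x ∧ p.2 0 = a} :=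
      (hAtm x).inter (hcoord a)
    have hi : Integrable (fun p : X × W d =>
        if p.1 ∈ measurableAtom x ∧ p.2 0 = a then (1 : ℝ) else 0) pl := by
      have := (integrable_const (μ := pl) (1 : ℝ)).indicator hms
      refine this.congr (Eventually.of_forall fun p => ?_)
      simp [Set.indicator_apply]
    have e2 : (1 : ℝ) ≤ ∫ p : X × W d,
        (1 + if p.1 ∈ measurableAtom x ∧ p.2 0 = a then (1 : ℝ) else 0) ∂pl := by
      rw [integral_add (integrable_const _) hi]
      have : (0 : ℝ) ≤ ∫ p : X × W d,
        (if p.1 ∈ measurableAtom x ∧ p.2 0 = a then (1 : ℝ) else 0) ∂pl :=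
        integral_nonneg fun p => by dsimp only [Pi.zero_apply]; split_ifs <;> norm_num
      simpa using this
    rw [integral_congr_ae e1] at e
    have hne : ∫ p : X × W d, (1 + c * J (x, cons a p.2)) ∂pl ≠ 0 := by
      rw [e]; exact (lt_of_lt_of_le one_pos e2).ne'
    have h3 : Integrable (fun p : X × W d => 1 + c * J (x, cons a p.2)) pl := by
      by_contra hcon
      exact hne (integral_undef hcon)
    have h4 := (h3.sub (integrable_const (1 : ℝ))).const_mul c⁻¹
    refine h4.congr (Eventually.of_forall fun p => ?_)
    have : c ≠ 0 := (hcard x).ne'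
    simp only [Pi.sub_apply]
    field_simp
    ring
  have hnull : ∀ x : X, NullMeasurableSet {p : X × W d | p.1 = x} pl := by
    intro x
    have e1 := hC (fun x' _ _ => if x' = x then 1 else 0) (fun _ _ => continuous_const)
    have e2 := hC (fun x' _ _ => if x' ∈ measurableAtom x then 1 else 0)
      (fun _ _ => continuous_const)
    set c : ℝ := ((Finset.univ.filter (fun x' => x' ∈ measurableAtom x)).card : ℝ) with hc
    have s1 : ∀ p : X × W d, ∑ x' : X, ∑ a' : Fin d, J (x', cons a' p.2) *
        (if x' = x then (1 : ℝ) else 0) = ∑ a', J (x, cons a' p.2) := by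
      intro p
      rw [Finset.sum_eq_single x]
      · simp
      · intro x' _ h; simp [h]
      · simp
    have s2 : ∀ p : X × W d, ∑ x' : X, ∑ a' : Fin d, J (x', cons a' p.2) *
        (if x' ∈ measurableAtom x then (1 : ℝ) else 0) = c * ∑ a', J (x, cons a' p.2) := by
      intro p
      have : ∀ x' : X, ∑ a' : Fin d, J (x', cons a' p.2) *
          (if x' ∈ measurableAtom x then (1 : ℝ) else 0)
          = if x' ∈ measurableAtom x then ∑ a', J (x, cons a' p.2) else 0 := by
        intro x'
        by_cases hx' : x' ∈ measurableAtom x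
        · simp [hx', hatom x x' _ hx']
        · simp [hx']
      rw [Finset.sum_congr rfl (fun x' _ => this x'), ← Finset.sum_filter, Finset.sum_const,
        nsmul_eq_mul]
    simp only [s1] at e1
    simp only [s2] at e2
    rw [integral_const_mul, e1] at e2
    have s3 : ∫ p : X × W d, (if p.1 ∈ measurableAtom x then (1 : ℝ) else 0) ∂pl
        = pl.real {p : X × W d | p.1 ∈ measurableAtom x} := by
      rw [← integral_indicator_one (hAtm x)]
      rfl
    rw [s3] at e2
    by_cases hz : pl {p : X × W d | p.1 ∈ measurableAtom x} = 0
    · apply NullMeasurableSet.of_null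
      refine measure_mono_null ?_ hz
      intro p hp
      have hp : p.1 = x := hp
      simp [hp]
    · have hne : ∫ p : X × W d, (if p.1 = x then (1 : ℝ) else 0) ∂pl ≠ 0 := by
        intro h0
        rw [h0, mul_zero] at e2
        exact hz ((measureReal_eq_zero_iff).1 e2.symm)
      have hi : Integrable (fun p : X × W d => if p.1 = x then (1 : ℝ) else 0) pl := by
        by_contra hcon
        exact hne (integral_undef hcon)
      rw [← aemeasurable_indicator_const_iff (1 : ℝ)]
      refine hi.1.aemeasurable.congr (Eventually.of_forall fun p => ?_)
      simp [Set.indicator_apply]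
  refine ⟨hnull, fun x a => ?_⟩
  have hCyl : NullMeasurableSet {p : X × W d | p.1 = x ∧ p.2 0 = a} pl :=
    (hnull x).inter (hcoord a).nullMeasurableSet
  have hsm : Measurable (fun p : X × W d => shift p.2) := aux_shift_meas.comp measurable_snd
  set ν : Measure (W d) := pl.map Prod.snd with hν
  set ρ : Measure (W d) :=
    (pl.restrict {p : X × W d | p.1 = x ∧ p.2 0 = a}).map (fun p => shift p.2) with hρ
  have : IsFiniteMeasure ν := by rw [hν]; infer_instance
  have : IsFiniteMeasure ρ := by rw [hρ]; infer_instance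
  have hd := aux_dens (ν := ν) (ρ := ρ) (fun y => J (x, cons a y)) (hfm x a)
    ((integrable_map_measure (hfm x a).aestronglyMeasurable measurable_snd.aemeasurable).2
      (hInt x a)) (by
    intro g hg
    have hmm : Measurable (fun y => J (x, cons a y) * g y) := (hfm x a).mul hg.measurable
    rw [hν, hρ, integral_map measurable_snd.aemeasurable hmm.aestronglyMeasurable,
      integral_map hsm.aemeasurable hg.aestronglyMeasurable, ← integral_indicator₀ hCyl]
    have e := hC (fun x' a' y => if x' = x ∧ a' = a then g y else 0) (by
      intro x' a'
      by_cases h : x' = x ∧ a' = a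
      · simpa [h] using hg
      · simpa [h] using continuous_const)
    convert e using 2
    · funext p
      rw [Finset.sum_eq_single x, Finset.sum_eq_single a]
      · simp
      · intro a' _ h; simp [h]
      · simp
      · intro x' _ h; simp [h]
      · simp
    · funext p
      simp [Set.indicator_apply])
  refine ⟨ae_of_ae_map measurable_snd.aemeasurable hd.1, fun F hF => ?_⟩
  have hF' : Measurable (fun y => F (cons a y)) := hF.comp (aux_cons_meas a)
  calc ∫⁻ p in {p : X × W d | p.1 = x ∧ p.2 0 = a}, F p.2 ∂pl
      = ∫⁻ p in {p : X × W d | p.1 = x ∧ p.2 0 = a}, F (cons a (shift p.2)) ∂pl := by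
        apply lintegral_congr_ae
        filter_upwards [ae_restrict_mem₀ hCyl] with p hp
        have hp2 : p.2 0 = a := hp.2
        rw [← hp2, aux_cons_shift]
    _ = ∫⁻ y, F (cons a y) ∂ρ := by rw [hρ, lintegral_map hF' hsm]
    _ = ∫⁻ y, ENNReal.ofReal (J (x, cons a y)) * F (cons a y) ∂ν := by
        rw [hd.2, lintegral_withDensity_eq_lintegral_mul _ (hfm x a).ennreal_ofReal hF']
        rfl
    _ = _ := by
        have hmm : Measurable (fun y => ENNReal.ofReal (J (x, cons a y)) * F (cons a y)) :=
          (hfm x a).ennreal_ofReal.mul hF'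
        rw [hν, lintegral_map hmm measurable_snd]

/-- For a normalized Lipschitz potential `b` and a plan `pl ∈ Π(·,σ)` with Jacobian `J`,
one has `0 ≤ −∫ log J dpl ≤ −∫ b dpl`, with equality on the right iff `b = log J` a.e. -/
theorem entropy_inequality
    [Nonempty X] [DiscreteTopology X]
    (pl : Measure (X × W d)) (hpl : IsPlan pl)
    (b : X × W d → ℝ) (hblip : LipCost b) (hbnorm : IsNormalized b)
    (J : X × W d → ℝ) (hJmeas : Measurable J)
    (hJpos : ∀ᵐ p ∂pl, 0 < J p)
    (hJsum : ∀ᵐ p ∂pl, ∑ x : X, ∑ a : Fin d, J (x, cons a p.2) = 1)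
    (hCoV : ∀ w : X × W d → ℝ, Continuous w →
      ∫ p, ∑ x : X, ∑ a : Fin d,
          J (x, cons a p.2) * w (x, cons a p.2) ∂pl = ∫ p, w p ∂pl)
    (hInt : Integrable (fun p => Real.log (J p)) pl) :
    0 ≤ -∫ p, Real.log (J p) ∂pl ∧
      -∫ p, Real.log (J p) ∂pl ≤ -∫ p, b p ∂pl ∧
      (-∫ p, Real.log (J p) ∂pl = -∫ p, b p ∂pl ↔
        ∀ᵐ p ∂pl, b p = Real.log (J p)) := by
  classical
  have := hpl.1
  obtain ⟨hnull, hbr⟩ := aux_main pl J hJmeas hJsum hCoV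
  have hnn : ∀ᵐ p ∂pl, ∀ x a, 0 ≤ J (x, cons a p.2) := by
    rw [ae_all_iff]; intro x
    rw [ae_all_iff]; intro a
    exact (hbr x a).1
  have hle1 : ∀ᵐ p ∂pl, ∀ x a, J (x, cons a p.2) ≤ 1 := by
    filter_upwards [hnn, hJsum] with p h1 h2 x a
    rw [← h2]
    exact (Finset.single_le_sum (f := fun a => J (x, cons a p.2)) (fun a _ => h1 x a)
      (Finset.mem_univ a)).trans (Finset.single_le_sum (f := fun x => ∑ a, J (x, cons a p.2))
      (fun x _ => Finset.sum_nonneg fun a _ => h1 x a) (Finset.mem_univ x))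
  -- upper bound for lower integrals
  have hL : ∀ F : X × W d → ENNReal, (∀ x, Measurable fun y => F (x, y)) →
      ∫⁻ p, F p ∂pl ≤ ∫⁻ p, ∑ x : X, ∑ a : Fin d,
        ENNReal.ofReal (J (x, cons a p.2)) * F (x, cons a p.2) ∂pl := by
    intro F hF
    have hcov : (⋃ i : X × Fin d, {p : X × W d | p.1 = i.1 ∧ p.2 0 = i.2}) = Set.univ := by
      ext p
      simp
    have hmeas : ∀ x a, Measurable fun p : X × W d =>
        ENNReal.ofReal (J (x, cons a p.2)) * F (x, cons a p.2) := fun x a =>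
      ((hJmeas.comp (measurable_prodMk_left.comp
        ((aux_cons_meas a).comp measurable_snd))).ennreal_ofReal).mul
        ((hF x).comp ((aux_cons_meas a).comp measurable_snd))
    calc ∫⁻ p, F p ∂pl
        = ∫⁻ p in ⋃ i : X × Fin d, {p : X × W d | p.1 = i.1 ∧ p.2 0 = i.2}, F p ∂pl := by
          rw [hcov, Measure.restrict_univ]
      _ ≤ ∑' i : X × Fin d, ∫⁻ p in {p : X × W d | p.1 = i.1 ∧ p.2 0 = i.2}, F p ∂pl :=
          lintegral_iUnion_le _ _
      _ = ∑ i : X × Fin d, ∫⁻ p in {p : X × W d | p.1 = i.1 ∧ p.2 0 = i.2}, F p ∂pl :=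
          tsum_fintype _
      _ = ∑ i : X × Fin d, ∫⁻ p,
            ENNReal.ofReal (J (i.1, cons i.2 p.2)) * F (i.1, cons i.2 p.2) ∂pl := by
          refine Finset.sum_congr rfl fun i _ => ?_
          rw [← (hbr i.1 i.2).2 (fun y => F (i.1, y)) (hF i.1)]
          apply lintegral_congr_ae
          have hco : MeasurableSet {p : X × W d | p.2 0 = i.2} :=
            (show Measurable fun p : X × W d => p.2 0 from
              (measurable_pi_apply 0).comp measurable_snd) (measurableSet_singleton i.2)
          have hCyl : NullMeasurableSet {p : X × W d | p.1 = i.1 ∧ p.2 0 = i.2} pl :=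
            (hnull i.1).inter hco.nullMeasurableSet
          filter_upwards [ae_restrict_mem₀ hCyl] with p hp
          rw [← hp.1]
      _ = _ := by
          rw [Fintype.sum_prod_type, lintegral_finsetSum]
          · refine Finset.sum_congr rfl fun x _ => ?_
            rw [lintegral_finsetSum]
            exact fun a _ => hmeas x a
          · exact fun x _ => Finset.measurable_sum _ fun a _ => hmeas x a
  have hJx : ∀ x : X, Measurable fun y => J (x, y) := fun x => hJmeas.comp measurable_prodMk_left
  have hbx : ∀ x : X, Continuous fun y => b (x, y) := aux_lip_cont hblip
  -- J ≤ 1 almost everywhere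
  have hJle : ∀ᵐ p ∂pl, J p ≤ 1 := by
    have h := hL (fun p => if 1 < J p then 1 else 0) (fun x =>
      Measurable.ite (measurableSet_lt measurable_const (hJx x)) measurable_const measurable_const)
    have h0 : ∫⁻ p, ∑ x : X, ∑ a : Fin d,
        ENNReal.ofReal (J (x, cons a p.2)) * (if 1 < J (x, cons a p.2) then 1 else 0) ∂pl = 0 := by
      rw [lintegral_eq_zero_of_ae_eq_zero]
      filter_upwards [hle1] with p hp
      simp only [Pi.zero_apply]
      refine Finset.sum_eq_zero fun x _ => Finset.sum_eq_zero fun a _ => ?_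
      rw [if_neg (not_lt.2 (hp x a)), mul_zero]
    have h1 := le_antisymm (h.trans h0.le) bot_le
    rw [lintegral_eq_zero_iff (Measurable.ite (measurableSet_lt measurable_const hJmeas)
      measurable_const measurable_const)] at h1
    filter_upwards [h1] with p hp
    by_contra hc
    simp [not_le.1 hc] at hp
  -- measurability and integrability of b
  have hbae : AEMeasurable b pl := by
    have e : b = fun p => ∑ x : X, Set.indicator {p : X × W d | p.1 = x}
        (fun p => b (x, p.2)) p := by
      funext p
      simp [Set.indicator_apply]
    rw [e]
    refine Finset.aemeasurable_fun_sum _ fun x _ => ?_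
    exact (((hbx x).measurable.comp measurable_snd).aemeasurable).indicator₀ (hnull x)
  have hbint : Integrable b pl := by
    have hcont : Continuous b := by
      rw [continuous_prod_of_discrete_left]
      exact hbx
    obtain ⟨C, hC⟩ := isCompact_univ.exists_bound_of_continuousOn hcont.continuousOn
    exact Integrable.of_bound hbae.aestronglyMeasurable C
      (Eventually.of_forall fun p => hC p (Set.mem_univ p))
  -- the ratio
  have hRae : AEMeasurable (fun p => Real.exp (b p) / J p) pl :=
    (Real.measurable_exp.comp_aemeasurable hbae).div hJmeas.aemeasurable
  have hRlin : ∫⁻ p, ENNReal.ofReal (Real.exp (b p) / J p) ∂pl ≤ 1 := by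
    refine (hL (fun p => ENNReal.ofReal (Real.exp (b p) / J p)) (fun x =>
      ((Real.measurable_exp.comp (hbx x).measurable).div (hJx x)).ennreal_ofReal)).trans ?_
    calc _ ≤ ∫⁻ p, 1 ∂pl := by
          apply lintegral_mono_ae
          filter_upwards [hnn] with p hp
          calc _ ≤ ∑ x : X, ∑ a : Fin d, ENNReal.ofReal (Real.exp (b (x, cons a p.2))) := by
                refine Finset.sum_le_sum fun x _ => Finset.sum_le_sum fun a _ => ?_
                rw [← ENNReal.ofReal_mul (hp x a)]
                apply ENNReal.ofReal_le_ofReal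
                rcases (hp x a).eq_or_lt with h | h
                · rw [← h]; simpa using (Real.exp_pos _).le
                · rw [mul_div_cancel₀ _ h.ne']
            _ = ENNReal.ofReal (∑ x : X, ∑ a : Fin d, Real.exp (b (x, cons a p.2))) := by
                rw [ENNReal.ofReal_sum_of_nonneg
                  (fun x _ => Finset.sum_nonneg fun a _ => (Real.exp_pos _).le)]
                refine Finset.sum_congr rfl fun x _ => ?_
                rw [ENNReal.ofReal_sum_of_nonneg (fun a _ => (Real.exp_pos _).le)]
            _ = 1 := by rw [hbnorm p.2, ENNReal.ofReal_one]
      _ = 1 := by simp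
  have hRnn : 0 ≤ᵐ[pl] fun p => Real.exp (b p) / J p := by
    filter_upwards [hJpos] with p hp
    exact (div_pos (Real.exp_pos _) hp).le
  have hRint : Integrable (fun p => Real.exp (b p) / J p) pl := by
    refine ⟨hRae.aestronglyMeasurable, ?_⟩
    rw [hasFiniteIntegral_iff_ofReal hRnn]
    exact hRlin.trans_lt ENNReal.one_lt_top
  have hR1 : ∫ p, Real.exp (b p) / J p ∂pl ≤ 1 := by
    rw [integral_eq_lintegral_of_nonneg_ae hRnn hRae.aestronglyMeasurable]
    exact ENNReal.toReal_le_of_le_ofReal zero_le_one (by simpa using hRlin)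
  -- the pointwise gap
  have hratio : ∀ᵐ p ∂pl, Real.exp (b p) / J p = Real.exp (b p - Real.log (J p)) := by
    filter_upwards [hJpos] with p hp
    rw [Real.exp_sub, Real.exp_log hp]
  have hGint : Integrable
      (fun p => Real.exp (b p) / J p - 1 - (b p - Real.log (J p))) pl :=
    (hRint.sub (integrable_const 1)).sub (hbint.sub hInt)
  have hGnn : 0 ≤ᵐ[pl] fun p => Real.exp (b p) / J p - 1 - (b p - Real.log (J p)) := by
    filter_upwards [hratio] with p hp
    rw [Pi.zero_apply, hp]
    linarith [Real.add_one_le_exp (b p - Real.log (J p))]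
  have hGval : ∫ p, (Real.exp (b p) / J p - 1 - (b p - Real.log (J p))) ∂pl
      = ∫ p, Real.exp (b p) / J p ∂pl - 1 - (∫ p, b p ∂pl - ∫ p, Real.log (J p) ∂pl) := by
    have h1 : Integrable (fun p => Real.exp (b p) / J p - 1) pl :=
      hRint.sub (integrable_const 1)
    have h2 : Integrable (fun p => b p - Real.log (J p)) pl := hbint.sub hInt
    rw [integral_sub h1 h2, integral_sub hRint (integrable_const 1), integral_sub hbint hInt]
    simp
  have hG0 := integral_nonneg_of_ae hGnn
  refine ⟨?_, ?_, ?_, ?_⟩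
  · have : ∫ p, Real.log (J p) ∂pl ≤ 0 := by
      apply integral_nonpos_of_ae
      filter_upwards [hJpos, hJle] with p h1 h2
      exact Real.log_nonpos h1.le h2
    linarith
  · linarith
  · intro heq
    have hz : ∫ p, (Real.exp (b p) / J p - 1 - (b p - Real.log (J p))) ∂pl = 0 := by
      linarith
    rw [integral_eq_zero_iff_of_nonneg_ae hGnn hGint] at hz
    filter_upwards [hz, hratio] with p h1 h2
    by_contra hne
    have hlt := Real.add_one_lt_exp (sub_ne_zero.2 hne)
    rw [← h2] at hlt
    simp only [Pi.zero_apply] at h1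
    linarith
  · intro h
    rw [integral_congr_ae h]
end

section
/- Let μ ∈ P(X) with full support and c Lipschitz. Suppose φ̃ : X → ℝ is continuous with P(c − φ̃) = 0 and ∫_X φ̃ dμ = sup_{π ∈ Π(μ,σ)} (∫ c dπ + H(π)). Then the Gibbs plan π_{c−φ̃} for c − φ̃ (normalized appropriately) lies in Π(μ,σ) and is the unique maximizer of sup_{π ∈ Π(μ,σ)} (∫ c dπ + H(π)). -/
open MeasureTheory Filter Topology

attribute [local instance] PiNat.dist

variable {X : Type*} [Fintype X] [MeasurableSpace X] [TopologicalSpace X] {d : ℕ}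

/-- `pl ∈ Π(μ,σ)`: a plan whose `x`-marginal is `μ` and whose `y`-marginal is
`σ`-invariant. -/
def IsPlanMu {X : Type*} [Fintype X] [MeasurableSpace X] {d : ℕ}
    (μ : Measure X) (pl : Measure (X × W d)) : Prop :=
  IsPlan pl ∧ ∀ f : X → ℝ, ∫ p, f p.1 ∂pl = ∫ x, f x ∂μ


set_option linter.unusedSectionVars false
set_option linter.style.haveILetI false

/-! ### Elementary facts about the shift space -/

lemma cons_shift_self {d : ℕ} (y : W d) : cons (y 0) (shift y) = y := by
  funext n; cases n <;> rfl

lemma dist_cons_le {d : ℕ} (a : Fin d) (y z : W d) :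
    dist (cons a y) (cons a z) ≤ 1 / 2 * dist y z := by
  rcases eq_or_ne y z with rfl | h
  · rw [PiNat.dist_self, PiNat.dist_self]; simp
  · rw [PiNat.dist_eq_of_ne h, ← pow_succ', ← PiNat.mem_cylinder_iff_dist_le,
      PiNat.mem_cylinder_iff]
    intro i hi
    cases i with
    | zero => rfl
    | succ i => exact PiNat.apply_eq_of_lt_firstDiff (x := y) (y := z) (by omega)

lemma dist_shift_le {d : ℕ} (y z : W d) :
    dist (shift y) (shift z) ≤ 2 * dist y z := by
  rcases eq_or_ne y z with rfl | h
  · rw [PiNat.dist_self, PiNat.dist_self]; simp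
  · rw [PiNat.dist_eq_of_ne h]
    rcases hn : PiNat.firstDiff y z with _ | m
    · have := PiNat.dist_le_one (shift y) (shift z)
      simp; linarith
    · have : shift y ∈ PiNat.cylinder (shift z) m := by
        rw [PiNat.mem_cylinder_iff]
        intro i hi
        exact PiNat.apply_eq_of_lt_firstDiff (x := y) (y := z) (by omega)
      have := PiNat.mem_cylinder_iff_dist_le.1 this
      rw [pow_succ]; linarith

lemma continuous_shift {d : ℕ} : Continuous (shift : W d → W d) :=
  continuous_pi fun n => continuous_apply (n + 1)

lemma continuous_cons {d : ℕ} (a : Fin d) : Continuous (cons a : W d → W d) := by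
  refine continuous_pi fun n => ?_
  cases n with
  | zero => exact continuous_const
  | succ n => exact continuous_apply n

/-- Lipschitz functions on the shift space are continuous. -/
lemma continuous_of_lip {d : ℕ} {g : W d → ℝ} {K : ℝ}
    (h : ∀ y z, |g y - g z| ≤ K * dist y z) : Continuous g := by
  letI : MetricSpace (W d) := PiNat.metricSpace
  have h2 : LipschitzWith (Real.toNNReal K) g := by
    refine LipschitzWith.of_dist_le_mul fun y z => ?_
    rw [Real.dist_eq]
    refine (h y z).trans ?_
    have h0 : (0 : ℝ) ≤ dist y z := PiNat.dist_nonneg y z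
    exact mul_le_mul_of_nonneg_right (Real.le_coe_toNNReal K) h0
  exact h2.continuous

lemma LipCost.exists_nonneg {c : X × W d → ℝ} (hc : LipCost c) :
    ∃ K : ℝ, 0 ≤ K ∧ ∀ (x : X) (y z : W d), |c (x, y) - c (x, z)| ≤ K * dist y z := by
  obtain ⟨K, hK⟩ := hc
  refine ⟨max K 0, le_max_right _ _, fun x y z => (hK x y z).trans ?_⟩
  exact mul_le_mul_of_nonneg_right (le_max_left _ _) (PiNat.dist_nonneg _ _)

lemma LipCost.add {c c' : X × W d → ℝ} (hc : LipCost c) (hc' : LipCost c') :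
    LipCost (fun p => c p + c' p) := by
  obtain ⟨K, hK⟩ := hc
  obtain ⟨K', hK'⟩ := hc'
  refine ⟨K + K', fun x y z => ?_⟩
  have h1 := hK x y z
  have h2 := hK' x y z
  have h3 := abs_add_le (c (x, y) - c (x, z)) (c' (x, y) - c' (x, z))
  rw [add_mul]
  refine le_trans (le_of_eq ?_) (h3.trans (add_le_add h1 h2))
  congr 1; ring

lemma LipCost.const_mul {c : X × W d → ℝ} (hc : LipCost c) (t : ℝ) :
    LipCost (fun p => t * c p) := by
  obtain ⟨K, hK⟩ := hc
  refine ⟨|t| * K, fun x y z => ?_⟩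
  rw [← mul_sub, abs_mul, mul_assoc]
  exact mul_le_mul_of_nonneg_left (hK x y z) (abs_nonneg t)

lemma LipCost.of_fst (f : X → ℝ) : LipCost (fun p : X × W d => f p.1) :=
  ⟨0, fun x y z => by simp⟩

lemma LipCost.of_snd {g : W d → ℝ} {K : ℝ} (h : ∀ y z, |g y - g z| ≤ K * dist y z) :
    LipCost (fun p : X × W d => g p.2) := ⟨K, fun _ y z => h y z⟩

lemma LipCost.comp_shift {g : W d → ℝ} {K : ℝ} (h : ∀ y z, |g y - g z| ≤ K * dist y z) :
    LipCost (fun p : X × W d => g (shift p.2)) := by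
  refine ⟨max K 0 * 2, fun _ y z => (h _ _).trans ?_⟩
  rw [mul_assoc]
  exact mul_le_mul (le_max_left _ _) (dist_shift_le y z) (PiNat.dist_nonneg _ _)
    (le_max_right _ _)

lemma LipCost.continuous [DiscreteTopology X] {c : X × W d → ℝ} (hc : LipCost c) :
    Continuous c := by
  obtain ⟨K, hK⟩ := hc
  rw [continuous_prod_of_discrete_left]
  intro x
  exact continuous_of_lip (hK x)

lemma LipCost.bounded {c : X × W d → ℝ} (hc : LipCost c) :
    ∃ B : ℝ, 0 ≤ B ∧ ∀ p, |c p| ≤ B := by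
  obtain ⟨K, hK0, hK⟩ := hc.exists_nonneg
  by_cases hne : Nonempty (W d)
  · obtain ⟨y₀⟩ := hne
    refine ⟨(∑ x, |c (x, y₀)|) + K, by positivity, fun ⟨x, y⟩ => ?_⟩
    have h1 := hK x y y₀
    have h2 : K * dist y y₀ ≤ K := mul_le_of_le_one_right hK0 (PiNat.dist_le_one _ _)
    have h3 : |c (x, y₀)| ≤ ∑ x, |c (x, y₀)| :=
      Finset.single_le_sum (f := fun x => |c (x, y₀)|) (fun _ _ => abs_nonneg _)
        (Finset.mem_univ x)
    have h4 := abs_sub_abs_le_abs_sub (c (x, y)) (c (x, y₀))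
    linarith
  · exact ⟨0, le_rfl, fun p => (hne ⟨p.2⟩).elim⟩

/-! ### Log-sum-exp of a cost over the preimages -/

/-- `G f y = log ∑_x ∑_a exp f(x, a y)`. -/
noncomputable def lse (f : X × W d → ℝ) (y : W d) : ℝ :=
  Real.log (∑ x : X, ∑ a : Fin d, Real.exp (f (x, cons a y)))

lemma sum_exp_pos [Nonempty X] [NeZero d] (f : X × W d → ℝ) (y : W d) :
    0 < ∑ x : X, ∑ a : Fin d, Real.exp (f (x, cons a y)) :=
  Finset.sum_pos (fun _ _ => Finset.sum_pos (fun _ _ => Real.exp_pos _)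
    Finset.univ_nonempty) Finset.univ_nonempty

lemma exp_lse [Nonempty X] [NeZero d] (f : X × W d → ℝ) (y : W d) :
    Real.exp (lse f y) = ∑ x : X, ∑ a : Fin d, Real.exp (f (x, cons a y)) :=
  Real.exp_log (sum_exp_pos f y)

lemma lse_le [Nonempty X] [NeZero d] (f g : X × W d → ℝ) (y z : W d) (r : ℝ)
    (h : ∀ x a, f (x, cons a y) ≤ g (x, cons a z) + r) : lse f y ≤ lse g z + r := by
  rw [← Real.exp_le_exp, Real.exp_add, exp_lse, exp_lse, Finset.sum_mul]
  refine Finset.sum_le_sum fun x _ => ?_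
  rw [Finset.sum_mul]
  refine Finset.sum_le_sum fun a _ => ?_
  rw [← Real.exp_add]
  exact Real.exp_le_exp.2 (h x a)

lemma abs_lse_sub_le [Nonempty X] [NeZero d] (f g : X × W d → ℝ) (y z : W d) (r : ℝ)
    (h : ∀ x a, |f (x, cons a y) - g (x, cons a z)| ≤ r) : |lse f y - lse g z| ≤ r := by
  rw [abs_sub_le_iff]
  constructor
  · have := lse_le f g y z r fun x a => by have := (abs_le.1 (h x a)).2; linarith
    linarith
  · have := lse_le g f z y r fun x a => by have := (abs_le.1 (h x a)).1; linarith
    linarith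

lemma lse_lip [Nonempty X] [NeZero d] {f : X × W d → ℝ} {K : ℝ} (hK : 0 ≤ K)
    (h : ∀ (x : X) (y z : W d), |f (x, y) - f (x, z)| ≤ K * dist y z) (y z : W d) :
    |lse f y - lse f z| ≤ K / 2 * dist y z := by
  refine abs_lse_sub_le f f y z _ fun x a => (h _ _ _).trans ?_
  have := mul_le_mul_of_nonneg_left (dist_cons_le a y z) hK
  linarith

lemma lse_add_const [Nonempty X] [NeZero d] (f : X × W d → ℝ) (r : ℝ) (y : W d) :
    lse (fun p => f p + r) y = lse f y + r := by
  apply le_antisymm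
  · exact lse_le _ _ _ _ _ fun x a => le_rfl
  · have := lse_le f (fun p => f p + r) y y (-r) fun x a => by simp
    linarith

/-- Normalization of a Lipschitz cost. -/
lemma normalize_cost [Nonempty X] [NeZero d] {f : X × W d → ℝ} (hf : LipCost f) :
    LipCost (fun p => f p - lse f (shift p.2)) ∧
      IsNormalized (fun p => f p - lse f (shift p.2)) := by
  constructor
  · obtain ⟨K, hK0, hK⟩ := hf.exists_nonneg
    have h1 := (LipCost.comp_shift (X := X) (lse_lip hK0 hK)).const_mul (-1)
    have h2 := hf.add h1
    simpa [sub_eq_add_neg] using h2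
  · intro y
    have : ∀ x a, Real.exp (f (x, cons a y) - lse f (shift (cons a y))) =
        Real.exp (f (x, cons a y)) * (Real.exp (lse f y))⁻¹ := fun x a => by
      rw [Real.exp_sub, div_eq_mul_inv]; rfl
    simp only [this, ← Finset.sum_mul]
    rw [exp_lse]
    exact mul_inv_cancel₀ (sum_exp_pos f y).ne'

lemma IsNormalized.nonpos {b : X × W d → ℝ} (hb : IsNormalized b) (p : X × W d) :
    b p ≤ 0 := by
  obtain ⟨x, y⟩ := p
  have h := hb (shift y)
  have h1 : Real.exp (b (x, cons (y 0) (shift y))) ≤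
      ∑ a : Fin d, Real.exp (b (x, cons a (shift y))) :=
    Finset.single_le_sum (f := fun a => Real.exp (b (x, cons a (shift y))))
      (fun _ _ => (Real.exp_pos _).le) (Finset.mem_univ (y 0))
  have h2 : ∑ a : Fin d, Real.exp (b (x, cons a (shift y))) ≤ 1 := by
    rw [← h]
    exact Finset.single_le_sum (f := fun x => ∑ a : Fin d, Real.exp (b (x, cons a (shift y))))
      (fun _ _ => Finset.sum_nonneg fun _ _ => (Real.exp_pos _).le) (Finset.mem_univ x)
  rw [cons_shift_self] at h1
  exact Real.exp_le_one_iff.1 (h1.trans h2)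

/-! ### Ultrafilter limits -/

lemma exists_ulim (a : ℕ → ℝ) (B : ℝ) (h : ∀ n, |a n| ≤ B) :
    ∃ l, Tendsto a (hyperfilter ℕ : Filter ℕ) (𝓝 l) := by
  have hc : IsCompact (Set.Icc (-B) B) := isCompact_Icc
  obtain ⟨l, -, hl⟩ := hc.ultrafilter_le_nhds ((hyperfilter ℕ).map a) (by
    rw [le_principal_iff]
    exact Filter.Eventually.of_forall (f := (hyperfilter ℕ : Filter ℕ))
      (p := fun n => a n ∈ Set.Icc (-B) B) fun n => abs_le.1 (h n))
  exact ⟨l, hl⟩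

/-! ### The eigenfunction, by the discounted method -/

lemma discounted [Nonempty X] [NeZero d] {A : X × W d → ℝ} {K : ℝ} (hK : 0 ≤ K)
    (hA : ∀ (x : X) (y z : W d), |A (x, y) - A (x, z)| ≤ K * dist y z)
    (s : ℝ) (hs0 : 0 ≤ s) (hs1 : s < 1) :
    ∃ u : W d → ℝ, (∀ y z, |u y - u z| ≤ K * dist y z) ∧
      ∀ y, u y = lse (fun p => A p + s * u p.2) y := by
  let T : (W d → ℝ) → (W d → ℝ) := fun u => lse (fun p => A p + s * u p.2)
  have hTlip : ∀ u : W d → ℝ, (∀ y z, |u y - u z| ≤ K * dist y z) →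
      ∀ y z, |T u y - T u z| ≤ K * dist y z := by
    intro u hu y z
    have h := lse_lip (f := fun p : X × W d => A p + s * u p.2) (K := 2 * K)
      (by positivity) (fun x y z => by
        have h1 := hA x y z
        have h2 := hu y z
        have h3 : |s * u y - s * u z| ≤ K * dist y z := by
          rw [← mul_sub, abs_mul, abs_of_nonneg hs0]
          exact (mul_le_of_le_one_left (abs_nonneg _) hs1.le).trans h2
        have h4 := abs_add_le (A (x, y) - A (x, z)) (s * u y - s * u z)
        have h5 : A (x, y) + s * u y - (A (x, z) + s * u z) =
          A (x, y) - A (x, z) + (s * u y - s * u z) := by ring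
        simp only [h5]
        linarith) y z
    rwa [mul_div_cancel_left₀ _ (two_ne_zero)] at h
  let u : ℕ → W d → ℝ := fun n => T^[n] 0
  have hu1 : ∀ n, u (n + 1) = T (u n) := fun n => Function.iterate_succ_apply' T n 0
  have hlip : ∀ n y z, |u n y - u n z| ≤ K * dist y z := by
    intro n
    induction n with
    | zero => intro y z; simpa [u] using mul_nonneg hK (PiNat.dist_nonneg y z)
    | succ n ih => rw [hu1]; exact hTlip _ ih
  let y₀ : W d := fun _ => 0
  let C : ℝ := |u 1 y₀| + K
  have hstep : ∀ n y, |u n y - u (n + 1) y| ≤ C * s ^ n := by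
    intro n
    induction n with
    | zero =>
      intro y
      have h1 := hlip 1 y y₀
      have h2 : K * dist y y₀ ≤ K := mul_le_of_le_one_right hK (PiNat.dist_le_one _ _)
      have h4 := abs_sub_abs_le_abs_sub (u 1 y) (u 1 y₀)
      have h5 : |u 0 y - u (0 + 1) y| = |u 1 y| := by simp [u]
      rw [h5, pow_zero, mul_one]
      simp only [C]
      linarith
    | succ n ih =>
      intro y
      rw [hu1 (n + 1)]
      nth_rewrite 1 [hu1 n]
      refine abs_lse_sub_le _ _ _ _ _ fun x a => ?_
      have : A (x, cons a y) + s * u n (cons a y) -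
          (A (x, cons a y) + s * u (n + 1) (cons a y)) =
          s * (u n (cons a y) - u (n + 1) (cons a y)) := by ring
      simp only [this, abs_mul, abs_of_nonneg hs0]
      have h := mul_le_mul_of_nonneg_left (ih (cons a y)) hs0
      rw [pow_succ]; linarith
  have hlim : ∀ y, ∃ l, Tendsto (fun n => u n y) atTop (𝓝 l) := by
    intro y
    apply cauchySeq_tendsto_of_complete
    refine cauchySeq_of_le_geometric s C hs1 fun n => ?_
    rw [Real.dist_eq]; exact hstep n y
  choose v hv using hlim
  refine ⟨v, fun y z => ?_, fun y => ?_⟩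
  · exact le_of_tendsto ((hv y).sub (hv z)).abs (Eventually.of_forall fun n => hlip n y z)
  · have h1 : Tendsto (fun n => u (n + 1) y) atTop (𝓝 (v y)) :=
      (tendsto_add_atTop_iff_nat 1).2 (hv y)
    have h2 : Tendsto (fun n => u (n + 1) y) atTop
        (𝓝 (lse (fun p => A p + s * v p.2) y)) := by
      simp only [hu1]
      refine Tendsto.log ?_ (sum_exp_pos (fun p => A p + s * v p.2) y).ne'
      refine tendsto_finsetSum _ fun x _ => tendsto_finsetSum _ fun a _ => ?_
      exact (Real.continuous_exp.tendsto _).comp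
        (tendsto_const_nhds.add (tendsto_const_nhds.mul (hv _)))
    exact tendsto_nhds_unique h1 h2

lemma eigenfunction [Nonempty X] [NeZero d] {A : X × W d → ℝ} (hA : LipCost A) :
    ∃ (u : W d → ℝ) (K r : ℝ), (∀ y z, |u y - u z| ≤ K * dist y z) ∧
      ∀ y, lse (fun p => A p + u p.2) y = u y + r := by
  obtain ⟨K, hK0, hK⟩ := hA.exists_nonneg
  let s : ℕ → ℝ := fun n => 1 - 1 / ((n : ℝ) + 1)
  have hs1 : ∀ n, s n < 1 := fun n => by
    have : 0 < 1 / ((n : ℝ) + 1) := by positivity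
    simp only [s]; linarith
  have hs0 : ∀ n, 0 ≤ s n := fun n => by
    have : 1 / ((n : ℝ) + 1) ≤ 1 := by
      rw [div_le_one (by positivity)]
      have : (0 : ℝ) ≤ n := Nat.cast_nonneg n
      linarith
    simp only [s]; linarith
  have hs : Tendsto s (hyperfilter ℕ : Filter ℕ) (𝓝 1) := by
    have : Tendsto s atTop (𝓝 1) := by
      simpa [s] using tendsto_const_nhds.sub (tendsto_one_div_add_atTop_nhds_zero_nat (𝕜 := ℝ))
        (a := (1 : ℝ))
    exact this.mono_left Nat.hyperfilter_le_atTop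
  choose v hvlip hv using fun n => discounted hK0 hK (s n) (hs0 n) (hs1 n)
  let y₀ : W d := fun _ => 0
  let w : ℕ → W d → ℝ := fun n y => v n y - v n y₀
  have hw : ∀ n y, w n y = lse (fun p => A p + s n * w n p.2) y -
      lse (fun p => A p + s n * w n p.2) y₀ := by
    intro n y
    have h : ∀ y, v n y = lse (fun p => A p + s n * w n p.2) y + s n * v n y₀ := by
      intro y
      rw [← lse_add_const]
      nth_rewrite 1 [hv n y]
      congr 1
      funext p
      simp only [w]; ring
    have h1 := h y
    have h2 := h y₀
    simp only [w] at h1 h2 ⊢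
    linarith
  have hwb : ∀ n y, |w n y| ≤ K := fun n y =>
    (hvlip n y y₀).trans (mul_le_of_le_one_right hK0 (PiNat.dist_le_one _ _))
  choose u hu using fun y => exists_ulim (fun n => w n y) K fun n => hwb n y
  have hl : ∀ y, Tendsto (fun n => lse (fun p => A p + s n * w n p.2) y)
      (hyperfilter ℕ : Filter ℕ) (𝓝 (lse (fun p => A p + u p.2) y)) := by
    intro y
    refine Tendsto.log ?_ (sum_exp_pos (fun p => A p + u p.2) y).ne'
    refine tendsto_finsetSum _ fun x _ => tendsto_finsetSum _ fun a _ => ?_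
    refine (Real.continuous_exp.tendsto _).comp (tendsto_const_nhds.add ?_)
    simpa using hs.mul (hu (cons a y))
  refine ⟨u, K, lse (fun p => A p + u p.2) y₀, fun y z => ?_, fun y => ?_⟩
  · refine le_of_tendsto ((hu y).sub (hu z)).abs (Eventually.of_forall fun n => ?_)
    have := hvlip n y z
    simpa [w] using this
  · have h1 := (hl y).sub (hl y₀)
    simp only [← hw] at h1
    have := tendsto_nhds_unique h1 (hu y)
    linarith

/-! ### The transfer operator -/

/-- The transfer operator. -/
noncomputable def Lop (b : X × W d → ℝ) (u : X × W d → ℝ) (y : W d) : ℝ :=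
  ∑ x : X, ∑ a : Fin d, Real.exp (b (x, cons a y)) * u (x, cons a y)

lemma Lop_mono (b : X × W d → ℝ) {u v : X × W d → ℝ} (h : ∀ p, u p ≤ v p) (y : W d) :
    Lop b u y ≤ Lop b v y :=
  Finset.sum_le_sum fun _ _ => Finset.sum_le_sum fun _ _ =>
    mul_le_mul_of_nonneg_left (h _) (Real.exp_pos _).le

lemma Lop_add (b : X × W d → ℝ) (u v : X × W d → ℝ) (y : W d) :
    Lop b (fun p => u p + v p) y = Lop b u y + Lop b v y := by
  simp only [Lop, mul_add, Finset.sum_add_distrib]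

lemma Lop_smul (b : X × W d → ℝ) (t : ℝ) (u : X × W d → ℝ) (y : W d) :
    Lop b (fun p => t * u p) y = t * Lop b u y := by
  simp only [Lop, Finset.mul_sum]
  refine Finset.sum_congr rfl fun x _ => Finset.sum_congr rfl fun a _ => by ring

lemma Lop_snd {b : X × W d → ℝ} (hb : IsNormalized b) (g : W d → ℝ) (y : W d) :
    Lop b (fun p => g (shift p.2)) y = g y := by
  have : Lop b (fun p => g (shift p.2)) y =
      (∑ x : X, ∑ a : Fin d, Real.exp (b (x, cons a y))) * g y := by
    simp only [Lop, Finset.sum_mul]; rfl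
  rw [this, hb y, one_mul]

lemma Lop_const {b : X × W d → ℝ} (hb : IsNormalized b) (r : ℝ) (y : W d) :
    Lop b (fun _ => r) y = r := Lop_snd hb (fun _ => r) y

lemma Lop_abs_le {b : X × W d → ℝ} (hb : IsNormalized b) {u : X × W d → ℝ} {B : ℝ}
    (h : ∀ p, |u p| ≤ B) (y : W d) : |Lop b u y| ≤ B := by
  rw [abs_le]
  constructor
  · rw [← Lop_const hb (-B) y]; exact Lop_mono b (fun p => (abs_le.1 (h p)).1) y
  · rw [← Lop_const hb B y]; exact Lop_mono b (fun p => (abs_le.1 (h p)).2) y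

lemma Lop_continuous [DiscreteTopology X] {b u : X × W d → ℝ} (hb : Continuous b)
    (hu : Continuous u) : Continuous (Lop b u) := by
  have hc : ∀ (x : X) (a : Fin d), Continuous fun y : W d => (x, cons a y) := fun x a =>
    continuous_const.prodMk (continuous_cons a)
  refine continuous_finsetSum _ fun x _ => continuous_finsetSum _ fun a _ => ?_
  exact (Real.continuous_exp.comp (hb.comp (hc x a))).mul (hu.comp (hc x a))

lemma abs_exp_sub_exp_le {s t : ℝ} (hs : s ≤ 0) (ht : t ≤ 0) :
    |Real.exp s - Real.exp t| ≤ |s - t| := by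
  have key : ∀ s t : ℝ, s ≤ 0 → Real.exp s - Real.exp t ≤ |s - t| := by
    intro s t hs
    have h1 : Real.exp t = Real.exp s * Real.exp (t - s) := by
      rw [← Real.exp_add]; congr 1; ring
    have h2 := Real.add_one_le_exp (t - s)
    have h3 : Real.exp s ≤ 1 := Real.exp_le_one_iff.2 hs
    have h4 := Real.exp_pos s
    have h5 := le_abs_self (s - t)
    have h6 := abs_nonneg (s - t)
    rw [h1]
    have h7 : Real.exp s * (t - s + 1) ≤ Real.exp s * Real.exp (t - s) :=
      mul_le_mul_of_nonneg_left h2 h4.le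
    have h8 : Real.exp s * (s - t) ≤ Real.exp s * |s - t| :=
      mul_le_mul_of_nonneg_left h5 h4.le
    have h9 : Real.exp s * |s - t| ≤ |s - t| := mul_le_of_le_one_left h6 h3
    nlinarith
  rw [abs_sub_le_iff]
  refine ⟨key s t hs, ?_⟩
  rw [abs_sub_comm]; exact key t s ht

lemma Lop_lip {b : X × W d → ℝ} (hb : IsNormalized b) {K : ℝ}
    (hK : ∀ (x : X) (y z : W d), |b (x, y) - b (x, z)| ≤ K * dist y z) (hK0 : 0 ≤ K)
    {u : X × W d → ℝ} {R B : ℝ} (hR0 : 0 ≤ R)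
    (hu : ∀ (x : X) (y z : W d), |u (x, y) - u (x, z)| ≤ R * dist y z)
    (hB : ∀ p, |u p| ≤ B) (y z : W d) :
    |Lop b u y - Lop b u z| ≤
      (R / 2 + (Fintype.card X : ℝ) * (d : ℝ) * K * B) * dist y z := by
  have hd0 := PiNat.dist_nonneg y z
  have hterm : ∀ (x : X) (a : Fin d),
      |Real.exp (b (x, cons a y)) * u (x, cons a y) -
        Real.exp (b (x, cons a z)) * u (x, cons a z)| ≤
      Real.exp (b (x, cons a y)) * (R / 2 * dist y z) + K * B * dist y z := by
    intro x a
    have hda := dist_cons_le a y z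
    have hda0 := PiNat.dist_nonneg (cons a y) (cons a z)
    have e : Real.exp (b (x, cons a y)) * u (x, cons a y) -
        Real.exp (b (x, cons a z)) * u (x, cons a z) =
        Real.exp (b (x, cons a y)) * (u (x, cons a y) - u (x, cons a z)) +
        (Real.exp (b (x, cons a y)) - Real.exp (b (x, cons a z))) * u (x, cons a z) := by ring
    rw [e]
    refine (abs_add_le _ _).trans (add_le_add ?_ ?_)
    · rw [abs_mul, abs_of_pos (Real.exp_pos _)]
      refine mul_le_mul_of_nonneg_left ((hu _ _ _).trans ?_) (Real.exp_pos _).le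
      have := mul_le_mul_of_nonneg_left hda hR0
      linarith
    · rw [abs_mul]
      have h1 := (abs_exp_sub_exp_le (hb.nonpos (x, cons a y)) (hb.nonpos (x, cons a z))).trans
        (hK x _ _)
      have h2 : K * dist (cons a y) (cons a z) ≤ K * dist y z :=
        mul_le_mul_of_nonneg_left (by linarith) hK0
      have h3 := mul_le_mul (h1.trans h2) (hB (x, cons a z)) (abs_nonneg _)
        (mul_nonneg hK0 hd0)
      linarith
  have hsum : |Lop b u y - Lop b u z| ≤ ∑ x : X, ∑ a : Fin d,
      (Real.exp (b (x, cons a y)) * (R / 2 * dist y z) + K * B * dist y z) := by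
    simp only [Lop]
    rw [← Finset.sum_sub_distrib]
    refine (Finset.abs_sum_le_sum_abs _ _).trans (Finset.sum_le_sum fun x _ => ?_)
    rw [← Finset.sum_sub_distrib]
    exact (Finset.abs_sum_le_sum_abs _ _).trans (Finset.sum_le_sum fun a _ => hterm x a)
  refine hsum.trans (le_of_eq ?_)
  have hn := hb y
  simp only [Finset.sum_add_distrib, ← Finset.sum_mul, hn]
  simp
  ring

/-- Transfer operator on functions of `y` only. -/
noncomputable def Qop (b : X × W d → ℝ) (v : W d → ℝ) : W d → ℝ := Lop b (fun p => v p.2)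

lemma Qop_neg (b : X × W d → ℝ) (v : W d → ℝ) : Qop b (-v) = -Qop b v := by
  funext y
  have := Lop_smul b (-1) (fun p => v p.2) y
  simpa [Qop] using this

lemma Qop_iter_neg (b : X × W d → ℝ) (v : W d → ℝ) (n : ℕ) :
    (Qop b)^[n] (-v) = -(Qop b)^[n] v := by
  induction n with
  | zero => rfl
  | succ n ih => rw [Function.iterate_succ_apply', ih, Qop_neg, Function.iterate_succ_apply']

lemma Qop_iter_le [Nonempty X] [NeZero d] {b : X × W d → ℝ} (hb : IsNormalized b) {δ : ℝ}
    (hδ0 : 0 < δ) (hδ : ∀ p, δ ≤ Real.exp (b p)) (v : W d → ℝ) (M : ℝ) (hM : ∀ y, v y ≤ M)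
    (N : ℕ) (y : W d) :
    (Qop b)^[N] v y ≤ M - δ ^ N * (M - v ((cons 0)^[N] y)) := by
  have hone : ∀ (w : W d → ℝ), (∀ y, w y ≤ M) → ∀ y,
      Qop b w y ≤ M - δ * (M - w (cons 0 y)) := by
    intro w hw y
    let x₀ : X := Classical.arbitrary X
    have h1 : Qop b w y = M - Lop b (fun p => M - w p.2) y := by
      have h := Lop_add b (fun p => w p.2) (fun p => M - w p.2) y
      simp only [add_sub_cancel] at h
      rw [Lop_const hb] at h
      simp only [Qop]; linarith
    have h2 : Real.exp (b (x₀, cons 0 y)) * (M - w (cons 0 y)) ≤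
        Lop b (fun p => M - w p.2) y := by
      have nn : ∀ (x : X) (a : Fin d),
          0 ≤ Real.exp (b (x, cons a y)) * (M - w (cons a y)) := fun x a =>
        mul_nonneg (Real.exp_pos _).le (sub_nonneg.2 (hw _))
      refine le_trans ?_ (Finset.single_le_sum
        (f := fun x => ∑ a : Fin d, Real.exp (b (x, cons a y)) * (M - w (cons a y)))
        (fun x _ => Finset.sum_nonneg fun a _ => nn x a) (Finset.mem_univ x₀))
      exact Finset.single_le_sum
        (f := fun a => Real.exp (b (x₀, cons a y)) * (M - w (cons a y)))
        (fun a _ => nn x₀ a) (Finset.mem_univ 0)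
    have h3 : δ * (M - w (cons 0 y)) ≤ Real.exp (b (x₀, cons 0 y)) * (M - w (cons 0 y)) :=
      mul_le_mul_of_nonneg_right (hδ _) (sub_nonneg.2 (hw _))
    linarith
  induction N generalizing y with
  | zero => simp
  | succ N ih =>
    rw [Function.iterate_succ_apply', Function.iterate_succ_apply]
    have hle : ∀ y, (Qop b)^[N] v y ≤ M := fun y => by
      have := ih y
      have h2 : 0 ≤ δ ^ N * (M - v ((cons 0)^[N] y)) :=
        mul_nonneg (pow_pos hδ0 N).le (sub_nonneg.2 (hM _))
      linarith
    have h1 := hone _ hle y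
    have h2 := mul_le_mul_of_nonneg_left (ih (cons 0 y)) hδ0.le
    rw [pow_succ]
    nlinarith

lemma dist_iter_cons_le [NeZero d] (N : ℕ) (y z : W d) :
    dist ((cons 0)^[N] y) ((cons 0)^[N] z) ≤ (1 / 2) ^ N := by
  induction N with
  | zero => simpa using PiNat.dist_le_one y z
  | succ N ih =>
    rw [Function.iterate_succ_apply', Function.iterate_succ_apply', pow_succ']
    exact (dist_cons_le _ _ _).trans (by linarith)

lemma osc_decay [Nonempty X] [NeZero d] {b : X × W d → ℝ} (hbL : LipCost b)
    (hb : IsNormalized b) {v : W d → ℝ} {R₀ : ℝ}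
    (hv : ∀ y z, |v y - v z| ≤ R₀ * dist y z) (η : ℝ) (hη : 0 < η) :
    ∃ n, ∀ y z, (Qop b)^[n] v y - (Qop b)^[n] v z ≤ η := by
  obtain ⟨K, hK0, hK⟩ := hbL.exists_nonneg
  obtain ⟨Bb, -, hBb⟩ := hbL.bounded
  obtain ⟨B, hB0, hB⟩ := (LipCost.of_snd (X := X) hv).bounded
  let C : ℝ := (Fintype.card X : ℝ) * (d : ℝ) * K * B
  have hC0 : 0 ≤ C := by positivity
  let R : ℝ := max R₀ (2 * C)
  have hR0 : 0 ≤ R := (by positivity : 0 ≤ 2 * C).trans (le_max_right _ _)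
  have hQB : ∀ n y, |(Qop b)^[n] v y| ≤ B := by
    intro n
    induction n with
    | zero => intro y; exact hB (Classical.arbitrary X, y)
    | succ n ih =>
      intro y
      rw [Function.iterate_succ_apply']
      exact Lop_abs_le hb (fun p => ih p.2) y
  have hQR : ∀ n y z, |(Qop b)^[n] v y - (Qop b)^[n] v z| ≤ R * dist y z := by
    intro n
    induction n with
    | zero =>
      intro y z
      exact (hv y z).trans (mul_le_mul_of_nonneg_right (le_max_left _ _) (PiNat.dist_nonneg _ _))
    | succ n ih =>
      intro y z
      rw [Function.iterate_succ_apply']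
      refine (Lop_lip hb hK hK0 hR0 (fun _ y z => ih y z) (fun p => hQB n p.2) y z).trans ?_
      refine mul_le_mul_of_nonneg_right ?_ (PiNat.dist_nonneg _ _)
      have : 2 * C ≤ R := le_max_right _ _
      simp only [C] at this
      linarith
  let δ := Real.exp (-Bb)
  have hδ0 : 0 < δ := Real.exp_pos _
  have hδ : ∀ p, δ ≤ Real.exp (b p) := fun p => Real.exp_le_exp.2 (abs_le.1 (hBb p)).1
  have hδ1 : δ ≤ 1 := by
    let p₀ : X × W d := (Classical.arbitrary X, fun _ => 0)
    exact (hδ p₀).trans (Real.exp_le_one_iff.2 (hb.nonpos p₀))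
  obtain ⟨N, hN⟩ : ∃ N : ℕ, R * (1 / 2 : ℝ) ^ N ≤ η / 2 := by
    have h : Tendsto (fun N : ℕ => R * (1 / 2 : ℝ) ^ N) atTop (𝓝 (R * 0)) :=
      (tendsto_pow_atTop_nhds_zero_of_lt_one (by norm_num) (by norm_num)).const_mul R
    rw [mul_zero] at h
    obtain ⟨N, hN⟩ := (h.eventually (gt_mem_nhds (half_pos hη))).exists
    exact ⟨N, hN.le⟩
  let ε := δ ^ N
  have hε0 : 0 < ε := pow_pos hδ0 N
  have hε1 : ε ≤ 1 := pow_le_one₀ hδ0.le hδ1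
  -- the set of oscillation bounds
  let T : Set ℝ := {t | ∃ n, ∀ y z, (Qop b)^[n] v y - (Qop b)^[n] v z ≤ t}
  have hTne : (2 * B) ∈ T := ⟨0, fun y z => by
    have h1 := (abs_le.1 (hQB 0 y)).2
    have h2 := (abs_le.1 (hQB 0 z)).1
    linarith⟩
  have hTbdd : BddBelow T := ⟨0, fun t ⟨n, hn⟩ => by
    have := hn (fun _ => 0) (fun _ => 0)
    linarith⟩
  have hTstep : ∀ t ∈ T, (1 - ε) * t + ε * (η / 2) ∈ T := by
    rintro t ⟨n, hn⟩
    refine ⟨N + n, fun y z => ?_⟩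
    rw [Function.iterate_add_apply]
    set w := (Qop b)^[n] v with hw
    have hbw : BddBelow (Set.range w) := ⟨-B, by
      rintro _ ⟨y, rfl⟩; exact (abs_le.1 (hQB n y)).1⟩
    let m := ⨅ y, w y
    have hm : ∀ y, m ≤ w y := fun y => ciInf_le hbw y
    have hM : ∀ y, w y ≤ m + t := fun y => by
      have : w y - t ≤ m := le_ciInf fun z => by have := hn y z; linarith
      linarith
    have h1 := Qop_iter_le hb hδ0 hδ w (m + t) hM N y
    have h2 := Qop_iter_le hb hδ0 hδ (-w) (-m) (fun y => by simpa using hm y) N z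
    rw [Qop_iter_neg] at h2
    simp only [Pi.neg_apply] at h2
    have h3 : w ((cons 0)^[N] y) - w ((cons 0)^[N] z) ≤ η / 2 :=
      (le_abs_self _).trans ((hQR n _ _).trans
        ((mul_le_mul_of_nonneg_left (dist_iter_cons_le N y z) hR0).trans hN))
    have h4 := mul_le_mul_of_nonneg_left h3 hε0.le
    simp only [ε] at h4 ⊢
    nlinarith
  have hθ : sInf T ≤ η / 2 := by
    by_contra hcon
    push Not at hcon
    have hall : ∀ t ∈ T, sInf T + ε * (sInf T - η / 2) ≤ t := by
      intro t ht
      have h1 := csInf_le hTbdd (hTstep t ht)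
      have h2 := csInf_le hTbdd ht
      by_contra hlt
      push Not at hlt
      nlinarith [mul_nonneg (sub_nonneg.2 hε1) (sub_nonneg.2 hlt.le),
        mul_pos hε0 (sub_pos.2 hcon), mul_pos (mul_pos hε0 hε0) (sub_pos.2 hcon)]
    have := le_csInf ⟨_, hTne⟩ hall
    nlinarith [mul_pos hε0 (sub_pos.2 hcon)]
  obtain ⟨t, ⟨n, hn⟩, ht⟩ := exists_lt_of_csInf_lt ⟨_, hTne⟩ (show sInf T < η by linarith)
  exact ⟨n, fun y z => (hn y z).trans ht.le⟩

/-! ### Measures -/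

lemma borel_prod [DiscreteTopology X] [MeasurableSingletonClass X] :
    BorelSpace (X × W d) := by
  infer_instance

lemma integrable_cont [DiscreteTopology X] [MeasurableSingletonClass X]
    {f : X × W d → ℝ} (hf : Continuous f) (π : Measure (X × W d)) [IsProbabilityMeasure π] :
    Integrable f π := by
  have := hf.continuousOn (s := Set.univ)
  have h := this.integrableOn_compact (μ := π) isCompact_univ
  rwa [integrableOn_univ] at h

/-- Ultrafilter limits of normalized positive functionals are represented by probabilities. -/
lemma exists_limit_measure [DiscreteTopology X] [MeasurableSingletonClass X]
    (F : ℕ → C(X × W d, ℝ) →ₗ[ℝ] ℝ) (hpos : ∀ n u, (∀ p, 0 ≤ u p) → 0 ≤ F n u)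
    (hone : ∀ n, F n 1 = 1) :
    ∃ π : Measure (X × W d), IsProbabilityMeasure π ∧
      ∀ u : C(X × W d, ℝ), Tendsto (fun n => F n u) (hyperfilter ℕ : Filter ℕ)
        (𝓝 (∫ p, u p ∂π)) := by
  have hmono : ∀ n u v, (∀ p, u p ≤ v p) → F n u ≤ F n v := by
    intro n u v h
    have := hpos n (v - u) fun p => by simpa using h p
    rw [map_sub] at this
    linarith
  have hconst : ∀ n r, F n (ContinuousMap.const _ r) = r := by
    intro n r
    have : (ContinuousMap.const (X × W d) r) = r • (1 : C(X × W d, ℝ)) := by ext; simp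
    rw [this, map_smul, hone]; simp
  have hbd : ∀ n u, |F n u| ≤ ‖u‖ := by
    intro n u
    rw [abs_le]
    constructor
    · rw [← hconst n (-‖u‖)]
      exact hmono n _ _ fun p => (abs_le.1 (u.norm_coe_le_norm p)).1
    · rw [← hconst n ‖u‖]
      exact hmono n _ _ fun p => (abs_le.1 (u.norm_coe_le_norm p)).2
  choose Λ hΛ using fun u => exists_ulim (fun n => F n u) ‖u‖ fun n => hbd n u
  have hadd : ∀ u v, Λ (u + v) = Λ u + Λ v := fun u v =>
    tendsto_nhds_unique (hΛ (u + v)) (by simpa using (hΛ u).add (hΛ v))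
  have hsmul : ∀ (r : ℝ) u, Λ (r • u) = r * Λ u := fun r u =>
    tendsto_nhds_unique (hΛ (r • u)) (by simpa using (hΛ u).const_mul r)
  have hLpos : ∀ u, (∀ p, 0 ≤ u p) → 0 ≤ Λ u := fun u hu =>
    ge_of_tendsto (hΛ u) (Eventually.of_forall fun n => hpos n u hu)
  have hL1 : Λ 1 = 1 := tendsto_nhds_unique (hΛ 1) (by simp [hone])
  let Φ : CompactlySupportedContinuousMap (X × W d) ℝ →ₚ[ℝ] ℝ :=
    PositiveLinearMap.mk₀
      { toFun := fun f => Λ f.toContinuousMap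
        map_add' := fun f g => hadd _ _
        map_smul' := fun r f => hsmul _ _ } (fun f hf => hLpos _ fun p => hf p)
  let π := RealRMK.rieszMeasure Φ
  have hInt : ∀ u : C(X × W d, ℝ), ∫ p, u p ∂π = Λ u := fun u =>
    RealRMK.integral_rieszMeasure Φ
      { toContinuousMap := u, hasCompactSupport' := HasCompactSupport.of_compactSpace _ }
  have hπ : IsProbabilityMeasure π := by
    have h := hInt 1
    rw [hL1] at h
    simp only [ContinuousMap.one_apply, integral_const, smul_eq_mul, mul_one] at h
    constructor
    have h2 := (ENNReal.toReal_eq_one_iff _).1 h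
    exact h2
  exact ⟨π, hπ, fun u => by rw [hInt]; exact hΛ u⟩

/-- Truncation: keep the first `n` coordinates. -/
def trunc [NeZero d] (n : ℕ) (y : W d) : W d := fun i => if i < n then y i else 0

lemma trunc_tendsto [NeZero d] (y : W d) : Tendsto (fun n => trunc n y) atTop (𝓝 y) := by
  rw [tendsto_pi_nhds]
  intro i
  refine tendsto_const_nhds.congr' ?_
  filter_upwards [eventually_gt_atTop i] with n hn
  simp [trunc, hn]

lemma trunc_lip [NeZero d] {u : X × W d → ℝ} {B : ℝ} (hB : ∀ p, |u p| ≤ B) (n : ℕ) :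
    LipCost (fun p => u (p.1, trunc n p.2)) := by
  refine ⟨2 * B * 2 ^ n, fun x y z => ?_⟩
  have hB0 : 0 ≤ B := (abs_nonneg _).trans (hB (x, y))
  by_cases h : y ∈ PiNat.cylinder z n
  · have : trunc n y = trunc n z := by
      funext i
      simp only [trunc]
      split_ifs with hi
      · exact PiNat.mem_cylinder_iff.1 h i hi
      · rfl
    simp only [this, sub_self, abs_zero]
    exact mul_nonneg (by positivity) (PiNat.dist_nonneg _ _)
  · rw [PiNat.mem_cylinder_iff_dist_le] at h
    push Not at h
    have h1 := abs_sub (u (x, trunc n y)) (u (x, trunc n z))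
    have h2 := hB (x, trunc n y)
    have h3 := hB (x, trunc n z)
    have h4 : (1 : ℝ) ≤ 2 ^ n * dist y z := by
      have : (2 : ℝ) ^ n * (1 / 2) ^ n = 1 := by rw [← mul_pow]; norm_num
      rw [← this]
      exact mul_le_mul_of_nonneg_left h.le (by positivity)
    have h5 : 2 * B * 1 ≤ 2 * B * (2 ^ n * dist y z) :=
      mul_le_mul_of_nonneg_left h4 (by positivity)
    dsimp only
    linarith

lemma cont_bounded [DiscreteTopology X] {u : X × W d → ℝ} (hu : Continuous u) :
    ∃ B, ∀ p, |u p| ≤ B := by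
  let f : C(X × W d, ℝ) := ⟨u, hu⟩
  exact ⟨‖f‖, fun p => f.norm_coe_le_norm p⟩

/-- It is enough to check the Gibbs property on Lipschitz functions. -/
lemma gibbs_of_lip [DiscreteTopology X] [MeasurableSingletonClass X] [NeZero d]
    {b : X × W d → ℝ} (hbc : Continuous b) (hb : IsNormalized b)
    {π : Measure (X × W d)} [IsProbabilityMeasure π]
    (h : ∀ u, LipCost u → ∫ p, u p ∂π = ∫ p, Lop b u p.2 ∂π) : GibbsFixed b π := by
  intro u hu
  obtain ⟨B, hB⟩ := cont_bounded hu
  have hpt : ∀ x y, Tendsto (fun n => u (x, trunc n y)) atTop (𝓝 (u (x, y))) := fun x y =>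
    (hu.tendsto _).comp (tendsto_const_nhds.prodMk_nhds (trunc_tendsto y))
  have hL := fun n => trunc_lip hB n
  have h1 : Tendsto (fun n => ∫ p, u (p.1, trunc n p.2) ∂π) atTop (𝓝 (∫ p, u p ∂π)) := by
    refine tendsto_integral_of_dominated_convergence (fun _ => B)
      (fun n => (hL n).continuous.aestronglyMeasurable) (integrable_const _)
      (fun n => Eventually.of_forall fun p => hB _) (Eventually.of_forall fun p => hpt _ _)
  have h2 : Tendsto (fun n => ∫ p, Lop b (fun p => u (p.1, trunc n p.2)) p.2 ∂π) atTop
      (𝓝 (∫ p, Lop b u p.2 ∂π)) := by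
    refine tendsto_integral_of_dominated_convergence (fun _ => B)
      (fun n => ((Lop_continuous hbc (hL n).continuous).comp
        continuous_snd).aestronglyMeasurable) (integrable_const _)
      (fun n => Eventually.of_forall fun p => Lop_abs_le hb (fun q => hB _) _)
      (Eventually.of_forall fun p => ?_)
    exact tendsto_finsetSum _ fun x _ => tendsto_finsetSum _ fun a _ =>
      (hpt _ _).const_mul _
  simp only [fun n => h _ (hL n)] at h1
  exact tendsto_nhds_unique h1 h2

lemma measure_ext_lip [DiscreteTopology X] [MeasurableSingletonClass X] [NeZero d]
    {π₁ π₂ : Measure (X × W d)} [IsProbabilityMeasure π₁] [IsProbabilityMeasure π₂]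
    (h : ∀ u : X × W d → ℝ, LipCost u → ∫ p, u p ∂π₁ = ∫ p, u p ∂π₂) : π₁ = π₂ := by
  apply ext_of_forall_integral_eq_of_IsFiniteMeasure
  intro f
  obtain ⟨B, hB⟩ := cont_bounded f.continuous
  have hL := fun n => trunc_lip hB n
  have hlim : ∀ (π : Measure (X × W d)) [IsProbabilityMeasure π],
      Tendsto (fun n => ∫ p, f (p.1, trunc n p.2) ∂π) atTop (𝓝 (∫ p, f p ∂π)) := by
    intro π _
    refine tendsto_integral_of_dominated_convergence (fun _ => B)
      (fun n => (hL n).continuous.aestronglyMeasurable) (integrable_const _)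
      (fun n => Eventually.of_forall fun p => hB _) (Eventually.of_forall fun p => ?_)
    exact (f.continuous.tendsto _).comp (tendsto_const_nhds.prodMk_nhds (trunc_tendsto p.2))
  have h1 := hlim π₁
  simp only [fun n => h _ (hL n)] at h1
  exact tendsto_nhds_unique h1 (hlim π₂)

/-- Uniqueness of the Gibbs plan. -/
lemma gibbs_unique [Nonempty X] [DiscreteTopology X] [MeasurableSingletonClass X] [NeZero d]
    {b : X × W d → ℝ} (hbL : LipCost b) (hb : IsNormalized b)
    {π₁ π₂ : Measure (X × W d)} [IsProbabilityMeasure π₁] [IsProbabilityMeasure π₂]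
    (h₁ : GibbsFixed b π₁) (h₂ : GibbsFixed b π₂) : π₁ = π₂ := by
  apply measure_ext_lip
  intro u hu
  obtain ⟨K, hK0, hK⟩ := hbL.exists_nonneg
  obtain ⟨R, hR0, hR⟩ := hu.exists_nonneg
  obtain ⟨B, hB0, hB⟩ := hu.bounded
  have hv := Lop_lip hb hK hK0 hR0 hR hB
  set v := Lop b u with hvdef
  have hcont : ∀ n, Continuous ((Qop b)^[n] v) := by
    intro n
    induction n with
    | zero => exact continuous_of_lip hv
    | succ n ih =>
      rw [Function.iterate_succ_apply']
      exact Lop_continuous hbL.continuous (ih.comp continuous_snd)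
  have hinv : ∀ (π : Measure (X × W d)), GibbsFixed b π → ∀ n,
      ∫ p, u p ∂π = ∫ p, (Qop b)^[n] v p.2 ∂π := by
    intro π hπ n
    induction n with
    | zero => exact hπ u hu.continuous
    | succ n ih =>
      rw [ih, Function.iterate_succ_apply']
      exact hπ (fun p => (Qop b)^[n] v p.2) ((hcont n).comp continuous_snd)
  apply eq_of_forall_dist_le
  intro η hη
  obtain ⟨n, hn⟩ := osc_decay hbL hb hv η hη
  rw [hinv π₁ h₁ n, hinv π₂ h₂ n]
  have hw := hcont n
  set w := (Qop b)^[n] v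
  let y₀ : W d := fun _ => 0
  have hwb : ∀ y y', w y ≤ w y' + η := fun y y' => by have := hn y y'; linarith
  have key : ∀ (ρ ρ' : Measure (X × W d)) [IsProbabilityMeasure ρ] [IsProbabilityMeasure ρ'],
      ∫ p, w p.2 ∂ρ ≤ ∫ p, w p.2 ∂ρ' + η := by
    intro ρ ρ' _ _
    have i1 : Integrable (fun p : X × W d => w p.2) ρ :=
      integrable_cont (hw.comp continuous_snd) ρ
    have i2 : Integrable (fun p : X × W d => w p.2) ρ' :=
      integrable_cont (hw.comp continuous_snd) ρ'
    have h1 : ∀ y, ∫ p, w p.2 ∂ρ ≤ w y + η := by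
      intro y
      have := integral_mono i1 (integrable_const (w y + η)) fun p => hwb p.2 y
      simpa using this
    have := integral_mono (integrable_const (∫ p, w p.2 ∂ρ - η)) i2 fun p => by
      have := h1 p.2
      dsimp only
      linarith
    simp only [integral_const, probReal_univ, one_smul] at this
    linarith
  rw [Real.dist_eq, abs_sub_le_iff]
  have h1 := key π₁ π₂
  have h2 := key π₂ π₁
  constructor <;> linarith

/-- A Gibbs measure for a normalized cost has invariant marginal. -/
lemma gibbs_isPlan [DiscreteTopology X] {b : X × W d → ℝ} (hb : IsNormalized b)
    {π : Measure (X × W d)} (hp : IsProbabilityMeasure π) (h : GibbsFixed b π) : IsPlan π := by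
  refine ⟨hp, fun g hg => ?_⟩
  have := h (fun p => g (shift p.2)) (hg.comp (continuous_shift.comp continuous_snd))
  rw [this]
  congr 1
  funext p
  exact Lop_snd hb g p.2

/-- Existence of a Gibbs measure. -/
lemma gibbs_exists [Nonempty X] [DiscreteTopology X] [MeasurableSingletonClass X] [NeZero d]
    {b : X × W d → ℝ} (hbc : Continuous b) (hb : IsNormalized b) :
    ∃ π : Measure (X × W d), IsProbabilityMeasure π ∧ GibbsFixed b π := by
  let L : C(X × W d, ℝ) →ₗ[ℝ] C(X × W d, ℝ) :=
    { toFun := fun u => ⟨fun p => Lop b u p.2, (Lop_continuous hbc u.continuous).comp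
        continuous_snd⟩
      map_add' := fun u v => by ext p; exact Lop_add b u v p.2
      map_smul' := fun r u => by ext p; exact Lop_smul b r u p.2 }
  let p₀ : X × W d := (Classical.arbitrary X, fun _ => 0)
  let ev : C(X × W d, ℝ) →ₗ[ℝ] ℝ :=
    { toFun := fun u => u p₀, map_add' := fun _ _ => rfl, map_smul' := fun _ _ => rfl }
  have hLpos : ∀ k u, (∀ p, 0 ≤ u p) → ∀ p, 0 ≤ (L ^ k) u p := by
    intro k u hu
    induction k with
    | zero => simpa using hu
    | succ k ih =>
      intro p
      rw [pow_succ']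
      change 0 ≤ Lop b ((L ^ k) u) p.2
      rw [← Lop_const hb 0 p.2]
      exact Lop_mono b ih p.2
  have hLb : ∀ k u, ∀ p, |(L ^ k) u p| ≤ ‖u‖ := by
    intro k u
    induction k with
    | zero => intro p; exact u.norm_coe_le_norm p
    | succ k ih =>
      intro p
      rw [pow_succ']
      exact Lop_abs_le hb ih p.2
  have hL1 : ∀ k, (L ^ k) 1 = 1 := by
    intro k
    induction k with
    | zero => rfl
    | succ k ih =>
      rw [pow_succ', Module.End.mul_apply, ih]
      ext p
      exact Lop_const hb 1 p.2
  let F : ℕ → C(X × W d, ℝ) →ₗ[ℝ] ℝ := fun n =>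
    ((n : ℝ) + 1)⁻¹ • ∑ k ∈ Finset.range (n + 1), ev.comp (L ^ k)
  have hF : ∀ n u, F n u = ((n : ℝ) + 1)⁻¹ * ∑ k ∈ Finset.range (n + 1), (L ^ k) u p₀ := by
    intro n u
    simp [F, LinearMap.sum_apply, ev]
  obtain ⟨π, hπ, hlim⟩ := exists_limit_measure F
    (fun n u hu => by
      rw [hF]
      exact mul_nonneg (by positivity) (Finset.sum_nonneg fun k _ => hLpos k u hu p₀))
    (fun n => by
      rw [hF]
      simp only [hL1]
      have : ((n : ℝ) + 1) ≠ 0 := by positivity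
      simp [this])
  refine ⟨π, hπ, fun u hu => ?_⟩
  let U : C(X × W d, ℝ) := ⟨u, hu⟩
  have hdiff : Tendsto (fun n => F n (L U) - F n U) (hyperfilter ℕ : Filter ℕ) (𝓝 0) := by
    refine Tendsto.mono_left ?_ Nat.hyperfilter_le_atTop
    have hz : Tendsto (fun n : ℕ => 2 * ‖U‖ * (1 / ((n : ℝ) + 1))) atTop (𝓝 0) := by
      simpa using (tendsto_one_div_add_atTop_nhds_zero_nat (𝕜 := ℝ)).const_mul (2 * ‖U‖)
    refine squeeze_zero_norm (fun n => ?_) hz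
    have e : F n (L U) - F n U = ((n : ℝ) + 1)⁻¹ * ((L ^ (n + 1)) U p₀ - (L ^ 0) U p₀) := by
      rw [hF, hF, ← mul_sub, ← Finset.sum_sub_distrib,
        ← Finset.sum_range_sub (fun k => (L ^ k) U p₀)]
      congr 1
    rw [e, Real.norm_eq_abs, abs_mul, abs_of_nonneg (by positivity), mul_comm, one_div]
    refine mul_le_mul_of_nonneg_right ?_ (by positivity)
    have h1 := hLb (n + 1) U p₀
    have h2 := hLb 0 U p₀
    have h3 := abs_sub ((L ^ (n + 1)) U p₀) ((L ^ 0) U p₀)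
    linarith
  have h1 := (hlim (L U)).sub (hlim U)
  have h2 := tendsto_nhds_unique h1 hdiff
  have h3 : ∫ p, U p ∂π = ∫ p, (L U) p ∂π := by linarith
  exact h3

/-! ### Entropy -/

lemma Hent_bdd (π : Measure (X × W d)) :
    BddBelow {r | ∃ b : X × W d → ℝ, LipCost b ∧ IsNormalized b ∧ r = -∫ p, b p ∂π} := by
  refine ⟨0, ?_⟩
  rintro _ ⟨b, -, hb, rfl⟩
  have : ∫ p, b p ∂π ≤ 0 := integral_nonpos fun p => hb.nonpos p
  linarith

lemma Hent_le {π : Measure (X × W d)} {b : X × W d → ℝ} (hbL : LipCost b)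
    (hb : IsNormalized b) : Hent π ≤ -∫ p, b p ∂π :=
  csInf_le (Hent_bdd π) ⟨b, hbL, hb, rfl⟩

lemma exists_normalized [Nonempty X] [NeZero d] :
    ∃ b : X × W d → ℝ, LipCost b ∧ IsNormalized b :=
  ⟨_, normalize_cost (LipCost.of_fst (fun _ : X => (0 : ℝ)))⟩

lemma le_Hent [Nonempty X] [NeZero d] {π : Measure (X × W d)} {r : ℝ}
    (h : ∀ b : X × W d → ℝ, LipCost b → IsNormalized b → r ≤ -∫ p, b p ∂π) : r ≤ Hent π := by
  obtain ⟨b, hbL, hb⟩ := exists_normalized (X := X) (d := d)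
  refine le_csInf ⟨_, b, hbL, hb, rfl⟩ ?_
  rintro _ ⟨b, hbL, hb, rfl⟩
  exact h b hbL hb

/-- Entropy of a Gibbs plan. -/
lemma Hent_gibbs [Nonempty X] [DiscreteTopology X] [MeasurableSingletonClass X] [NeZero d]
    {b : X × W d → ℝ} (hbL : LipCost b) (hb : IsNormalized b)
    {π : Measure (X × W d)} [IsProbabilityMeasure π] (h : GibbsFixed b π) :
    Hent π = -∫ p, b p ∂π := by
  apply le_antisymm (Hent_le hbL hb)
  apply le_Hent
  intro b' hbL' hb'
  have hc := hbL.continuous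
  have hc' := hbL'.continuous
  have hce : Continuous fun p => Real.exp (b' p - b p) := Real.continuous_exp.comp (hc'.sub hc)
  have h1 : ∫ p, Real.exp (b' p - b p) ∂π = 1 := by
    rw [h _ hce]
    have : ∀ p : X × W d, ∑ x : X, ∑ a : Fin d, Real.exp (b (x, cons a p.2)) *
        Real.exp (b' (x, cons a p.2) - b (x, cons a p.2)) = 1 := by
      intro p
      rw [← hb' p.2]
      refine Finset.sum_congr rfl fun x _ => Finset.sum_congr rfl fun a _ => ?_
      rw [← Real.exp_add]; congr 1; ring
    simp only [this]
    simp
  have h2 : ∫ p, (b' p - b p + 1) ∂π ≤ ∫ p, Real.exp (b' p - b p) ∂π :=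
    integral_mono (integrable_cont ((hc'.sub hc).add continuous_const) π)
      (integrable_cont hce π) fun p => Real.add_one_le_exp _
  rw [integral_add (integrable_cont (show Continuous fun p => b' p - b p from hc'.sub hc) π) (integrable_const _),
    integral_sub (integrable_cont hc' π) (integrable_cont hc π), h1] at h2
  simp at h2
  linarith

lemma integral_lse_shift [Nonempty X] [DiscreteTopology X] [NeZero d]
    {π : Measure (X × W d)} (hπ : IsPlan π) {f : X × W d → ℝ} (hf : LipCost f) :
    Continuous (lse f) ∧ ∫ p, lse f (shift p.2) ∂π = ∫ p, lse f p.2 ∂π := by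
  obtain ⟨K, hK0, hK⟩ := hf.exists_nonneg
  have hc := continuous_of_lip (lse_lip hK0 hK)
  exact ⟨hc, hπ.2 _ hc⟩

/-- If a normalized cost realizes the entropy of a plan, the plan is Gibbs. -/
lemma gibbs_of_Hent [Nonempty X] [DiscreteTopology X] [MeasurableSingletonClass X] [NeZero d]
    {b : X × W d → ℝ} (hbL : LipCost b) (hb : IsNormalized b)
    {π : Measure (X × W d)} (hπ : IsPlan π) (h : Hent π = -∫ p, b p ∂π) :
    GibbsFixed b π := by
  haveI := hπ.1
  have hbc := hbL.continuous
  -- first-order inequality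
  have key : ∀ u : X × W d → ℝ, LipCost u →
      ∫ p, u p ∂π ≤ ∫ p, Lop b u p.2 ∂π := by
    intro u hu
    obtain ⟨B, hB0, hB⟩ := hu.bounded
    have huc := hu.continuous
    have hLc : Continuous fun p : X × W d => Lop b u p.2 :=
      (Lop_continuous hbc huc).comp continuous_snd
    have hineq : ∀ t : ℝ, 0 < t → t * (B + 1) ≤ 1 →
        ∫ p, u p ∂π ≤ ∫ p, Lop b u p.2 ∂π + t * (B + 1) ^ 2 := by
      intro t ht htB
      have hf : LipCost (fun p => b p + t * u p) := hbL.add (hu.const_mul t)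
      obtain ⟨hn1, hn2⟩ := normalize_cost hf
      obtain ⟨hlc, hli⟩ := integral_lse_shift hπ hf
      have h1 := Hent_le (π := π) hn1 hn2
      have hlcs : Continuous fun p : X × W d => lse (fun p => b p + t * u p) (shift p.2) :=
        hlc.comp (continuous_shift.comp continuous_snd)
      have htL : Continuous fun p : X × W d => t * Lop b u p.2 := continuous_const.mul hLc
      rw [integral_sub (integrable_cont hf.continuous π) (integrable_cont hlcs π), hli,
        integral_add (integrable_cont hbc π) (integrable_cont (hu.const_mul t).continuous π),
        integral_const_mul, h] at h1
      have hpt : ∀ y : W d, lse (fun p => b p + t * u p) y ≤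
          t * Lop b u y + t ^ 2 * (B + 1) ^ 2 := by
        intro y
        have e1 : ∑ x : X, ∑ a : Fin d, Real.exp (b (x, cons a y) + t * u (x, cons a y)) =
            Lop b (fun p => Real.exp (t * u p)) y := by
          simp only [Lop, Real.exp_add]
        have e2 : lse (fun p => b p + t * u p) y ≤
            Lop b (fun p => Real.exp (t * u p)) y - 1 := by
          rw [← e1]
          exact Real.log_le_sub_one_of_pos (sum_exp_pos (fun p => b p + t * u p) y)
        have e3 : Lop b (fun p => Real.exp (t * u p)) y ≤
            Lop b (fun p => t * u p + (1 + t ^ 2 * (B + 1) ^ 2)) y := by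
          refine Lop_mono b (fun p => ?_) y
          have hup : |u p| ≤ B + 1 := (hB p).trans (by linarith)
          have h1 : |t * u p| ≤ 1 := by
            rw [abs_mul, abs_of_pos ht]
            exact (mul_le_mul_of_nonneg_left hup ht.le).trans htB
          have h2 := (abs_le.1 (Real.abs_exp_sub_one_sub_id_le h1)).2
          have h3 : (t * u p) ^ 2 ≤ t ^ 2 * (B + 1) ^ 2 := by
            rw [mul_pow]
            exact mul_le_mul_of_nonneg_left
              (sq_le_sq.2 (hup.trans (le_abs_self _))) (sq_nonneg t)
          linarith
        rw [Lop_add, Lop_const hb, Lop_smul] at e3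
        linarith
      have h2 : ∫ p, lse (fun p => b p + t * u p) p.2 ∂π ≤
          ∫ p, (t * Lop b u p.2 + t ^ 2 * (B + 1) ^ 2) ∂π :=
        integral_mono (integrable_cont (hlc.comp continuous_snd) π)
          (integrable_cont ((continuous_const.mul hLc).add continuous_const) π)
          fun p => hpt p.2
      rw [integral_add (integrable_cont htL π) (integrable_const _),
        integral_const_mul, integral_const, probReal_univ, one_smul] at h2
      have h3 : t * ∫ p, u p ∂π ≤ t * (∫ p, Lop b u p.2 ∂π + t * (B + 1) ^ 2) := by
        nlinarith
      exact le_of_mul_le_mul_left h3 ht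
    have hlim : Tendsto (fun t : ℝ => ∫ p, Lop b u p.2 ∂π + t * (B + 1) ^ 2) (𝓝[>] 0)
        (𝓝 (∫ p, Lop b u p.2 ∂π)) := by
      have : Continuous fun t : ℝ => ∫ p, Lop b u p.2 ∂π + t * (B + 1) ^ 2 := by fun_prop
      have h0 := this.tendsto 0
      simp only [zero_mul, add_zero] at h0
      exact h0.mono_left nhdsWithin_le_nhds
    refine ge_of_tendsto hlim ?_
    have hsm : ∀ᶠ t : ℝ in 𝓝[>] 0, t < 1 / (B + 1) :=
      nhdsWithin_le_nhds (gt_mem_nhds (by positivity))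
    filter_upwards [hsm, self_mem_nhdsWithin] with t ht1 ht0
    refine hineq t ht0 ?_
    have hB1 : 0 < B + 1 := by linarith
    exact ((lt_div_iff₀ hB1).1 ht1).le
  refine gibbs_of_lip hbc hb fun u hu => le_antisymm (key u hu) ?_
  have h1 := key _ (hu.const_mul (-1))
  simp only [Lop_smul, integral_const_mul] at h1
  linarith

/-- A plan with given marginal. -/
lemma exists_planMu [DiscreteTopology X] [MeasurableSingletonClass X] [NeZero d]
    (μ : Measure X) [IsProbabilityMeasure μ] :
    ∃ pl : Measure (X × W d), IsPlanMu μ pl := by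
  let y₀ : W d := fun _ => 0
  have hm : Measurable fun x : X => (x, y₀) := measurable_id.prodMk measurable_const
  have hInt : ∀ f : X × W d → ℝ, Continuous f →
      ∫ p, f p ∂(μ.map fun x : X => (x, y₀)) = ∫ x, f (x, y₀) ∂μ := fun f hf =>
    integral_map hm.aemeasurable hf.aestronglyMeasurable
  refine ⟨μ.map fun x => (x, y₀), ⟨Measure.isProbabilityMeasure_map hm.aemeasurable,
    fun g hg => ?_⟩, fun f => ?_⟩
  · rw [hInt (fun p => g (shift p.2)) (hg.comp (continuous_shift.comp continuous_snd)),
      hInt (fun p => g p.2) (hg.comp continuous_snd)]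
    rfl
  · exact hInt _ ((continuous_of_discreteTopology (f := f)).comp continuous_fst)

lemma functional_bdd [Nonempty X] [NeZero d] {c : X × W d → ℝ} (hc : LipCost c) :
    ∃ M : ℝ, ∀ π : Measure (X × W d), IsProbabilityMeasure π → ∫ p, c p ∂π + Hent π ≤ M := by
  obtain ⟨B, hB0, hB⟩ := hc.bounded
  obtain ⟨b, hbL, hb⟩ := exists_normalized (X := X) (d := d)
  obtain ⟨B', hB0', hB'⟩ := hbL.bounded
  refine ⟨B + B', fun π hπ => ?_⟩
  have h1 := Hent_le (π := π) hbL hb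
  have h2 : |∫ p, c p ∂π| ≤ B := by
    have := norm_integral_le_of_norm_le_const (μ := π) (f := c) (C := B)
      (Eventually.of_forall hB)
    simpa using this
  have h3 : |∫ p, b p ∂π| ≤ B' := by
    have := norm_integral_le_of_norm_le_const (μ := π) (f := b) (C := B')
      (Eventually.of_forall hB')
    simpa using this
  have := (abs_le.1 h2).2
  have := (abs_le.1 h3).1
  linarith

/-- Existence of a maximizer in `Π(μ,σ)`. -/
lemma exists_maximizer [Nonempty X] [DiscreteTopology X] [MeasurableSingletonClass X] [NeZero d]
    {c : X × W d → ℝ} (hc : LipCost c) (μ : Measure X) [IsProbabilityMeasure μ] :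
    ∃ pl : Measure (X × W d), IsPlanMu μ pl ∧ ∫ p, c p ∂pl + Hent pl =
      sSup {r | ∃ pl : Measure (X × W d), IsPlanMu μ pl ∧ r = ∫ p, c p ∂pl + Hent pl} := by
  set S := {r | ∃ pl : Measure (X × W d), IsPlanMu μ pl ∧ r = ∫ p, c p ∂pl + Hent pl} with hS
  obtain ⟨M, hM⟩ := functional_bdd hc
  have hbdd : BddAbove S := ⟨M, by rintro _ ⟨pl, hpl, rfl⟩; exact hM pl hpl.1.1⟩
  have hne : S.Nonempty := by
    obtain ⟨pl, hpl⟩ := exists_planMu (d := d) μ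
    exact ⟨_, pl, hpl, rfl⟩
  have hseq : ∀ n : ℕ, ∃ pl : Measure (X × W d), IsPlanMu μ pl ∧
      sSup S - 1 / ((n : ℝ) + 1) < ∫ p, c p ∂pl + Hent pl := by
    intro n
    have hpos : 0 < 1 / ((n : ℝ) + 1) := by positivity
    obtain ⟨_, ⟨pl, hpl, rfl⟩, hlt⟩ := exists_lt_of_lt_csSup hne (sub_lt_self (sSup S) hpos)
    exact ⟨pl, hpl, hlt⟩
  choose pl hpl hlt using hseq
  have hprob : ∀ n, IsProbabilityMeasure (pl n) := fun n => (hpl n).1.1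
  let F : ℕ → C(X × W d, ℝ) →ₗ[ℝ] ℝ := fun n =>
    { toFun := fun u => ∫ p, u p ∂(pl n)
      map_add' := fun u v => integral_add (integrable_cont u.continuous _)
        (integrable_cont v.continuous _)
      map_smul' := fun r u => integral_const_mul r u }
  obtain ⟨π, hπ, hlim⟩ := exists_limit_measure F
    (fun n u hu => integral_nonneg hu)
    (fun n => by
      change ∫ p, (1 : C(X × W d, ℝ)) p ∂(pl n) = 1
      simp)
  have hlim' : ∀ u : X × W d → ℝ, Continuous u →
      Tendsto (fun n => ∫ p, u p ∂(pl n)) (hyperfilter ℕ : Filter ℕ) (𝓝 (∫ p, u p ∂π)) :=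
    fun u hu => hlim ⟨u, hu⟩
  have hplan : IsPlanMu μ π := by
    refine ⟨⟨hπ, fun g hg => ?_⟩, fun f => ?_⟩
    · have h1 := hlim' _ (hg.comp (continuous_shift.comp continuous_snd))
      have h2 := hlim' _ (hg.comp continuous_snd)
      refine tendsto_nhds_unique h1 (h2.congr fun n => ?_)
      exact ((hpl n).1.2 g hg).symm
    · have h1 := hlim' _ ((continuous_of_discreteTopology (f := f)).comp continuous_fst)
      refine tendsto_nhds_unique h1 (tendsto_const_nhds.congr fun n => ?_)
      exact ((hpl n).2 f).symm
  refine ⟨π, hplan, le_antisymm (le_csSup hbdd ⟨π, hplan, rfl⟩) ?_⟩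
  have : sSup S - ∫ p, c p ∂π ≤ Hent π := by
    apply le_Hent
    intro b hbL hb
    have h1 := (hlim' c hc.continuous).sub (hlim' b hbL.continuous)
    have h2 : Tendsto (fun n : ℕ => sSup S - 1 / ((n : ℝ) + 1))
        (hyperfilter ℕ : Filter ℕ) (𝓝 (sSup S - 0)) :=
      (tendsto_const_nhds.sub (tendsto_one_div_add_atTop_nhds_zero_nat (𝕜 := ℝ))).mono_left
        Nat.hyperfilter_le_atTop
    have h3 := le_of_tendsto_of_tendsto' h2 h1 fun n => by
      have := hlt n
      have := Hent_le (π := pl n) hbL hb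
      linarith
    linarith
  linarith
/-- If `P(c − φ̃) = 0` and `∫ φ̃ dμ = sup_{pl ∈ Π(μ,σ)} ∫ c dpl + H(pl)`, then the Gibbs
plan for `c − φ̃` (suitably normalized by the eigenfunction `h` with eigenvalue `1`)
belongs to `Π(μ,σ)` and is the unique maximizer of `∫ c dpl + H(pl)` over `Π(μ,σ)`. -/
theorem gibbs_plan_is_unique_constrained_maximizer
    [Nonempty X] [DiscreteTopology X] [MeasurableSingletonClass X] (hd : 0 < d)
    (c : X × W d → ℝ) (hc : LipCost c)
    (μ : Measure X) (hμ : IsProbabilityMeasure μ) (hfull : ∀ x : X, 0 < μ {x})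
    (φt : X → ℝ)
    (hP : Pr (fun p : X × W d => c p - φt p.1) = 0)
    (hsup : ∫ x, φt x ∂μ =
      sSup {r | ∃ pl : Measure (X × W d), IsPlanMu μ pl ∧ r = ∫ p, c p ∂pl + Hent pl}) :
    ∃ (h : W d → ℝ) (pl₀ : Measure (X × W d)),
      Continuous h ∧ (∀ y, 0 < h y) ∧
      (∀ y : W d, ∑ x : X, ∑ a : Fin d,
        Real.exp (c (x, cons a y) - φt x) * h (cons a y) = h y) ∧
      GibbsFixed
        (fun p => c p - φt p.1 + Real.log (h p.2) - Real.log (h (shift p.2))) pl₀ ∧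
      IsPlanMu μ pl₀ ∧
      (∫ p, c p ∂pl₀ + Hent pl₀ =
        sSup {r | ∃ pl : Measure (X × W d), IsPlanMu μ pl ∧ r = ∫ p, c p ∂pl + Hent pl}) ∧
      ∀ pl : Measure (X × W d), IsPlanMu μ pl →
        (∫ p, c p ∂pl + Hent pl =
          sSup {r | ∃ pl' : Measure (X × W d), IsPlanMu μ pl' ∧
            r = ∫ p, c p ∂pl' + Hent pl'}) →
        pl = pl₀ := by
  haveI : NeZero d := ⟨hd.ne'⟩
  have hA : LipCost (fun p : X × W d => c p - φt p.1) := by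
    simpa [sub_eq_add_neg] using hc.add (LipCost.of_fst (d := d) (fun x => -φt x))
  obtain ⟨u, K, r, hulip, hu⟩ := eigenfunction hA
  have huc : Continuous u := continuous_of_lip hulip
  have hucs : Continuous fun p : X × W d => u p.2 := huc.comp continuous_snd
  have hucss : Continuous fun p : X × W d => u (shift p.2) :=
    huc.comp (continuous_shift.comp continuous_snd)
  have hf : LipCost (fun p : X × W d => c p - φt p.1 + u p.2) :=
    hA.add (LipCost.of_snd hulip)
  obtain ⟨hbL, hb⟩ := normalize_cost hf
  -- the integral of the normalized cost against a plan
  have hbint : ∀ π : Measure (X × W d), IsPlan π →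
      ∫ p, (c p - φt p.1 + u p.2 - lse (fun p => c p - φt p.1 + u p.2) (shift p.2)) ∂π =
        ∫ p, (c p - φt p.1) ∂π - r := by
    intro π hπ
    haveI := hπ.1
    obtain ⟨hlc, hli⟩ := integral_lse_shift hπ hf
    have hlcs : Continuous fun p : X × W d =>
        lse (fun p => c p - φt p.1 + u p.2) (shift p.2) :=
      hlc.comp (continuous_shift.comp continuous_snd)
    rw [integral_sub (integrable_cont hf.continuous π) (integrable_cont hlcs π), hli,
      integral_add (integrable_cont hA.continuous π) (integrable_cont hucs π)]
    simp only [hu]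
    rw [integral_add (integrable_cont hucs π) (integrable_const _)]
    simp only [integral_const, probReal_univ, one_smul]
    ring
  -- the eigenvalue is one
  have hr : r = 0 := by
    obtain ⟨π, hπ, hG⟩ := gibbs_exists hbL.continuous hb
    have hplan := gibbs_isPlan hb hπ hG
    have hent := Hent_gibbs hbL hb hG
    rw [hbint π hplan] at hent
    rw [← hP]
    have hub : ∀ s ∈ {s | ∃ π : Measure (X × W d), IsPlan π ∧
        s = ∫ p, (c p - φt p.1) ∂π + Hent π}, s ≤ r := by
      rintro _ ⟨π', hπ', rfl⟩
      have h1 := Hent_le (π := π') hbL hb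
      rw [hbint π' hπ'] at h1
      linarith
    have hmem : r ∈ {s | ∃ π : Measure (X × W d), IsPlan π ∧
        s = ∫ p, (c p - φt p.1) ∂π + Hent π} := ⟨π, hplan, by linarith⟩
    exact le_antisymm (le_csSup ⟨r, hub⟩ hmem) (csSup_le ⟨r, hmem⟩ hub)
  subst hr
  -- any constrained maximizer is Gibbs
  have hgibbs : ∀ pl : Measure (X × W d), IsPlanMu μ pl →
      (∫ p, c p ∂pl + Hent pl = sSup {r | ∃ pl' : Measure (X × W d), IsPlanMu μ pl' ∧
        r = ∫ p, c p ∂pl' + Hent pl'}) →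
      GibbsFixed (fun p => c p - φt p.1 + u p.2 -
        lse (fun p => c p - φt p.1 + u p.2) (shift p.2)) pl := by
    intro pl hpl hmax
    haveI := hpl.1.1
    refine gibbs_of_Hent hbL hb hpl.1 ?_
    rw [hbint pl hpl.1]
    rw [← hsup, ← hpl.2 φt] at hmax
    have hφc : Continuous fun p : X × W d => φt p.1 :=
      (continuous_of_discreteTopology (f := φt)).comp continuous_fst
    rw [integral_sub (integrable_cont hc.continuous pl) (integrable_cont hφc pl)]
    linarith
  obtain ⟨pl₀, hpl₀, hmax₀⟩ := exists_maximizer hc μ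
  have hG₀ := hgibbs pl₀ hpl₀ hmax₀
  refine ⟨fun y => Real.exp (u y), pl₀, Real.continuous_exp.comp huc,
    fun y => Real.exp_pos _, fun y => ?_, ?_, hpl₀, hmax₀, fun pl hpl hmax => ?_⟩
  · have h1 := exp_lse (fun p : X × W d => c p - φt p.1 + u p.2) y
    rw [hu y, add_zero] at h1
    dsimp only
    rw [h1]
    simp only [Real.exp_add]
  · simpa only [Real.log_exp, hu, add_zero] using hG₀
  · haveI := hpl.1.1
    haveI := hpl₀.1.1
    exact gibbs_unique hbL hb (hgibbs pl hpl hmax) hG₀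
end
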